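/- arXiv:2005.08492 — 7 statements merged into one kernel-verified Lean document; each statement's English description precedes it below -/
import Mathlib

section
/- Let X be a separable real Banach space. Then there exists a > 0 such that R(a, X) = 1 + a if and only if R(b, X) = 1 + b for all b > 0. -/
open Filter Topology

/-- The Domínguez-Benavides coefficient `R(a, X)`. -/
noncomputable def RCoeff (X : Type*) [NormedAddCommGroup X] [NormedSpace ℝ X] (a : ℝ) : ℝ :=
  sSup {r : ℝ | ∃ (x : X) (xs : ℕ → X), ‖x‖ ≤ a ∧ (∀ n, ‖xs n‖ ≤ 1) ∧
    (∀ f : X →L[ℝ] ℝ, Filter.Tendsto (fun n => f (xs n)) Filter.atTop (nhds 0)) ∧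
    Filter.limsup (fun n => Filter.limsup (fun m => ‖xs n - xs m‖) Filter.atTop) Filter.atTop ≤ 1 ∧
    r = Filter.liminf (fun n => ‖xs n + x‖) Filter.atTop}

/-- The set of lower limits whose supremum is `RCoeff X a`. -/
def liminfSet (X : Type*) [NormedAddCommGroup X] [NormedSpace ℝ X] (a : ℝ) : Set ℝ :=
  {r : ℝ | ∃ (x : X) (xs : ℕ → X), ‖x‖ ≤ a ∧ (∀ n, ‖xs n‖ ≤ 1) ∧
    (∀ f : X →L[ℝ] ℝ, Filter.Tendsto (fun n => f (xs n)) Filter.atTop (nhds 0)) ∧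
    Filter.limsup (fun n => Filter.limsup (fun m => ‖xs n - xs m‖) Filter.atTop) Filter.atTop ≤ 1 ∧
    r = Filter.liminf (fun n => ‖xs n + x‖) Filter.atTop}

section

variable {X : Type*} [NormedAddCommGroup X]

lemma norm_add_le_of_norm_le {a : ℝ} {x y : X} (hx : ‖x‖ ≤ a) (hy : ‖y‖ ≤ 1) :
    ‖y + x‖ ≤ 1 + a :=
  (norm_add_le _ _).trans (add_le_add hy hx)

lemma isBoundedUnder_ge_norm (u : ℕ → X) :
    IsBoundedUnder (· ≥ ·) atTop (fun n => ‖u n‖) :=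
  isBoundedUnder_of ⟨0, fun _ => norm_nonneg _⟩

variable [NormedSpace ℝ X]

lemma le_of_mem_liminfSet {a r : ℝ} (hr : r ∈ liminfSet X a) : r ≤ 1 + a := by
  obtain ⟨x, xs, hx, hxs, -, -, rfl⟩ := hr
  refine liminf_le_of_le (isBoundedUnder_ge_norm _) fun c hc => ?_
  obtain ⟨n, hn⟩ := hc.exists
  exact hn.trans (norm_add_le_of_norm_le hx (hxs n))

lemma liminfSet_nonempty {a : ℝ} (ha : 0 ≤ a) : (liminfSet X a).Nonempty :=
  ⟨_, 0, fun _ => 0, by simpa using ha, by simp, by simp, by simp, rfl⟩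

/-- If `‖y + x‖` is within `ε` of its maximal value `1 + a`, then `‖y + t • x‖` is within
`max 1 t * ε` of `1 + t * a`. -/
lemma le_norm_add_smul {a t ε : ℝ} (ht : 0 ≤ t) {x y : X} (hx : ‖x‖ ≤ a)
    (hy : ‖y‖ ≤ 1) (h : 1 + a - ε ≤ ‖y + x‖) :
    1 + t * a - max 1 t * ε ≤ ‖y + t • x‖ := by
  rcases le_total t 1 with h1 | h1
  · rw [max_eq_left h1]
    have h2 : ‖y + x‖ ≤ ‖y + t • x‖ + (1 - t) * ‖x‖ := by
      calc ‖y + x‖ = ‖(y + t • x) + (1 - t) • x‖ := by congr 1; module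
        _ ≤ _ := (norm_add_le _ _).trans_eq (by
          rw [norm_smul, Real.norm_of_nonneg (sub_nonneg.2 h1)])
    nlinarith
  · rw [max_eq_right h1]
    have h2 : t * ‖y + x‖ ≤ ‖y + t • x‖ + (t - 1) * ‖y‖ := by
      calc t * ‖y + x‖ = ‖t • (y + x)‖ := by rw [norm_smul, Real.norm_of_nonneg ht]
        _ = ‖(y + t • x) + (t - 1) • y‖ := by congr 1; module
        _ ≤ _ := (norm_add_le _ _).trans_eq (by
          rw [norm_smul, Real.norm_of_nonneg (sub_nonneg.2 h1)])
    nlinarith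

lemma RCoeff_eq_one_add_of_eq {a b : ℝ} (ha : 0 < a) (hb : 0 < b)
    (h : RCoeff X a = 1 + a) : RCoeff X b = 1 + b := by
  change sSup (liminfSet X a) = 1 + a at h
  change sSup (liminfSet X b) = 1 + b
  refine le_antisymm (csSup_le (liminfSet_nonempty hb.le) fun r => le_of_mem_liminfSet) ?_
  refine le_of_forall_pos_le_add fun δ hδ => ?_
  obtain ⟨t, ht, rfl⟩ : ∃ t : ℝ, 0 < t ∧ t * a = b := ⟨b / a, div_pos hb ha, by field_simp⟩
  have hM : 0 < max 1 t := lt_max_of_lt_left one_pos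
  have hlt : 1 + a - δ / max 1 t < sSup (liminfSet X a) := by
    rw [h]; linarith [div_pos hδ hM]
  obtain ⟨_, ⟨x, xs, hx, hxs, hweak, hsep, rfl⟩, hr⟩ :=
    exists_lt_of_lt_csSup (liminfSet_nonempty ha.le) hlt
  have hev := eventually_lt_of_lt_liminf hr (isBoundedUnder_ge_norm _)
  have hx' : ‖t • x‖ ≤ t * a := by
    rw [norm_smul, Real.norm_of_nonneg ht.le]; gcongr
  have hle : 1 + t * a - δ ≤ liminf (fun n => ‖xs n + t • x‖) atTop := by
    refine le_liminf_of_le (isBoundedUnder_of ⟨1 + t * a, fun n =>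
      norm_add_le_of_norm_le hx' (hxs n)⟩).isCoboundedUnder_ge ?_
    filter_upwards [hev] with n hn
    simpa [mul_div_cancel₀ δ hM.ne'] using le_norm_add_smul ht.le hx (hxs n) hn.le
  have hmem : liminf (fun n => ‖xs n + t • x‖) atTop ∈ liminfSet X (t * a) :=
    ⟨t • x, xs, hx', hxs, hweak, hsep, rfl⟩
  linarith [le_csSup ⟨1 + t * a, fun r => le_of_mem_liminfSet⟩ hmem]

end

theorem stmt0 (X : Type*) [NormedAddCommGroup X] [NormedSpace ℝ X] [CompleteSpace X]
    [TopologicalSpace.SeparableSpace X] :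
    (∃ a : ℝ, 0 < a ∧ RCoeff X a = 1 + a) ↔ (∀ b : ℝ, 0 < b → RCoeff X b = 1 + b) :=
  ⟨fun ⟨_, ha, h⟩ _ hb => RCoeff_eq_one_add_of_eq ha hb h, fun h => ⟨1, one_pos, h 1 one_pos⟩⟩
end

section
/- Let X be a separable real Banach space and let a, b be real numbers with 0 < a ≤ b. Then a·R(b, X) ≤ b·R(a, X); equivalently, the function a ↦ R(a, X)/a is nonincreasing on (0, ∞). -/
open Filter Topology

theorem limsup_const_mul_of_bounded {u : ℕ → ℝ} {c C t : ℝ} (hc : ∀ n, c ≤ u n)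
    (hC : ∀ n, u n ≤ C) (ht : 0 ≤ t) :
    limsup (fun n => t * u n) atTop = t * limsup u atTop :=
  ((monotone_mul_left_of_nonneg ht).map_limsup_of_continuousAt u
    (continuous_const_mul t).continuousAt (isBoundedUnder_of ⟨C, hC⟩)
    (isBoundedUnder_of (r := (· ≥ ·)) ⟨c, hc⟩).isCoboundedUnder_flip).symm

theorem liminf_const_mul_of_bounded {u : ℕ → ℝ} {c C t : ℝ} (hc : ∀ n, c ≤ u n)
    (hC : ∀ n, u n ≤ C) (ht : 0 ≤ t) :
    liminf (fun n => t * u n) atTop = t * liminf u atTop :=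
  ((monotone_mul_left_of_nonneg ht).map_liminf_of_continuousAt u
    (continuous_const_mul t).continuousAt
    (isBoundedUnder_of (r := (· ≤ ·)) ⟨C, hC⟩).isCoboundedUnder_flip
    (isBoundedUnder_of ⟨c, hc⟩)).symm

theorem limsup_mem_Icc {u : ℕ → ℝ} {c C : ℝ} (hc : ∀ n, c ≤ u n) (hC : ∀ n, u n ≤ C) :
    limsup u atTop ∈ Set.Icc c C :=
  ⟨le_limsup_of_frequently_le (Eventually.of_forall hc).frequently (isBoundedUnder_of ⟨C, hC⟩),
    limsup_le_of_le (isBoundedUnder_of (r := (· ≥ ·)) ⟨c, hc⟩).isCoboundedUnder_flip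
      (Eventually.of_forall hC)⟩

theorem stmt2 (X : Type*) [NormedAddCommGroup X] [NormedSpace ℝ X] [CompleteSpace X]
    [TopologicalSpace.SeparableSpace X] (a b : ℝ) (ha : 0 < a) (hab : a ≤ b) :
    a * RCoeff X b ≤ b * RCoeff X a := by
  have hb : 0 < b := ha.trans_le hab
  obtain ⟨t, ht⟩ : ∃ t, t = a / b := ⟨_, rfl⟩
  have ht0 : 0 < t := ht ▸ div_pos ha hb
  have ht1 : t ≤ 1 := ht ▸ (div_le_one hb).2 hab
  have htb : t * b = a := by rw [ht, div_mul_cancel₀ _ hb.ne']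
  suffices h : RCoeff X b ≤ t⁻¹ * RCoeff X a by
    rw [le_inv_mul_iff₀ ht0] at h
    calc a * RCoeff X b = b * (t * RCoeff X b) := by rw [← htb]; ring
      _ ≤ b * RCoeff X a := by gcongr
  refine csSup_le ⟨_, 0, fun _ => 0, by simpa using hb.le, by simp, by simp, by simp, rfl⟩ ?_
  rintro r ⟨x, xs, hx, hxs, hweak, hsep, rfl⟩
  rw [le_inv_mul_iff₀ ht0]
  refine le_csSup ⟨1 + a, ?_⟩ ⟨t • x, fun n => t • xs n, ?_, fun n => ?_, fun f => ?_, ?_, ?_⟩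
  · rintro r ⟨y, ys, hy, hys, -, -, rfl⟩
    refine liminf_le_of_frequently_le (Eventually.of_forall fun n => ?_).frequently
      (isBoundedUnder_of ⟨0, fun n => norm_nonneg _⟩)
    exact (norm_add_le _ _).trans (add_le_add (hys n) hy)
  · rw [norm_smul, Real.norm_of_nonneg ht0.le, ← htb]
    gcongr
  · rw [norm_smul, Real.norm_of_nonneg ht0.le]
    exact mul_le_one₀ ht1 (norm_nonneg _) (hxs n)
  · simpa using (hweak f).const_mul t
  · have hdist : ∀ n m, ‖xs n - xs m‖ ≤ 1 + 1 := fun n m =>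
      (norm_sub_le _ _).trans (add_le_add (hxs n) (hxs m))
    have hmem := fun n => limsup_mem_Icc (fun m => norm_nonneg (xs n - xs m)) (hdist n)
    simp_rw [← smul_sub, norm_smul, Real.norm_of_nonneg ht0.le,
      fun n => limsup_const_mul_of_bounded (fun m => norm_nonneg (xs n - xs m)) (hdist n) ht0.le]
    rw [limsup_const_mul_of_bounded (fun n => (hmem n).1) (fun n => (hmem n).2) ht0.le]
    exact mul_le_one₀ ht1 (limsup_mem_Icc (fun n => (hmem n).1) (fun n => (hmem n).2)).1 hsep
  · simp_rw [← smul_add, norm_smul, Real.norm_of_nonneg ht0.le]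
    exact (liminf_const_mul_of_bounded (fun n => norm_nonneg _)
      (fun n => (norm_add_le _ _).trans (add_le_add (hxs n) hx)) ht0.le).symm
end

section
/- Let X be a separable real Banach space. If there exists a > 0 such that R(a, X) = a, then R(b, X) = b for all b ≥ a. -/
open Filter Topology

section

variable {X : Type*} [NormedAddCommGroup X] {xs : ℕ → X}

lemma liminf_norm_add_le (h : ∀ n, ‖xs n‖ ≤ 1) (x : X) :
    liminf (fun n => ‖xs n + x‖) atTop ≤ 1 + ‖x‖ :=
  liminf_le_of_frequently_le
    (Frequently.of_forall fun n => (norm_add_le _ _).trans (by linarith [h n]))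
    (isBoundedUnder_of ⟨0, fun _ => norm_nonneg _⟩)

lemma liminf_norm_add_add_le (h : ∀ n, ‖xs n‖ ≤ 1) (x y : X) :
    liminf (fun n => ‖xs n + (x + y)‖) atTop ≤ liminf (fun n => ‖xs n + x‖) atTop + ‖y‖ := by
  have hle : ∀ z n, ‖xs n + z‖ ≤ 1 + ‖z‖ := fun z n =>
    (norm_add_le _ _).trans (by linarith [h n])
  have hbdd : IsBoundedUnder (· ≤ ·) atTop (fun n => ‖xs n + x‖) :=
    isBoundedUnder_of ⟨1 + ‖x‖, hle x⟩
  have hbdd' : IsBoundedUnder (· ≤ ·) atTop (fun n => ‖xs n + x‖ + ‖y‖) :=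
    isBoundedUnder_of ⟨1 + ‖x‖ + ‖y‖, fun n => by linarith [hle x n]⟩
  rw [← liminf_add_const atTop (fun n => ‖xs n + x‖) ‖y‖ hbdd.isCoboundedUnder_ge
    (isBoundedUnder_of ⟨0, fun _ => norm_nonneg _⟩)]
  refine liminf_le_liminf (Eventually.of_forall fun n => ?_)
    (isBoundedUnder_of ⟨0, fun _ => norm_nonneg _⟩) hbdd'.isCoboundedUnder_ge
  rw [← add_assoc]
  exact norm_add_le _ _

end

section

variable {X : Type*} [NormedAddCommGroup X] [NormedSpace ℝ X] {a : ℝ}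

lemma liminf_le_RCoeff {x : X} {xs : ℕ → X} (hx : ‖x‖ ≤ a) (h1 : ∀ n, ‖xs n‖ ≤ 1)
    (hw : ∀ f : X →L[ℝ] ℝ, Tendsto (fun n => f (xs n)) atTop (𝓝 0))
    (hs : limsup (fun n => limsup (fun m => ‖xs n - xs m‖) atTop) atTop ≤ 1) :
    liminf (fun n => ‖xs n + x‖) atTop ≤ RCoeff X a := by
  refine le_csSup ⟨1 + a, ?_⟩ ⟨x, xs, hx, h1, hw, hs, rfl⟩
  rintro _ ⟨y, ys, hy, h1', -, -, rfl⟩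
  exact (liminf_norm_add_le h1' y).trans (by linarith)

lemma norm_le_RCoeff {x : X} (hx : ‖x‖ ≤ a) : ‖x‖ ≤ RCoeff X a := by
  simpa using liminf_le_RCoeff (xs := fun _ => (0 : X)) hx (by simp) (by simp) (by simp)

lemma RCoeff_eq_zero_of_subsingleton [Subsingleton X] (ha : 0 ≤ a) : RCoeff X a = 0 := by
  refine le_antisymm (Real.sSup_nonpos ?_) (by simpa using norm_le_RCoeff (x := (0 : X)) (by simpa))
  rintro _ ⟨x, xs, -, -, -, -, rfl⟩
  simp [Subsingleton.elim _ (0 : X)]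

lemma RCoeff_le_add {b : ℝ} (ha : 0 ≤ a) (hab : a ≤ b) : RCoeff X b ≤ RCoeff X a + (b - a) := by
  have h0 : 0 ≤ RCoeff X a := by simpa using norm_le_RCoeff (x := (0 : X)) (a := a) (by simpa)
  refine Real.sSup_le ?_ (by linarith)
  rintro _ ⟨x, xs, hx, h1, hw, hs, rfl⟩
  rcases le_or_gt ‖x‖ a with hxa | hxa
  · linarith [liminf_le_RCoeff hxa h1 hw hs]
  have hpos : 0 < ‖x‖ := ha.trans_lt hxa
  set t := a / ‖x‖ with ht
  have ht0 : 0 ≤ t := by positivity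
  have ht1 : t ≤ 1 := (div_le_one hpos).2 hxa.le
  have htx : t * ‖x‖ = a := div_mul_cancel₀ a hpos.ne'
  have hy : ‖t • x‖ ≤ a := by rw [norm_smul, Real.norm_of_nonneg ht0, htx]
  have hz : ‖(1 - t) • x‖ = ‖x‖ - a := by
    rw [norm_smul, Real.norm_of_nonneg (by linarith), sub_mul, one_mul, htx]
  have hsum : t • x + (1 - t) • x = x := by rw [← add_smul]; simp
  have key := liminf_norm_add_add_le h1 (t • x) ((1 - t) • x)
  rw [hsum, hz] at key
  linarith [liminf_le_RCoeff hy h1 hw hs]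

end

theorem stmt3 (X : Type*) [NormedAddCommGroup X] [NormedSpace ℝ X] [CompleteSpace X]
    [TopologicalSpace.SeparableSpace X] (a : ℝ) (ha : 0 < a) (hRa : RCoeff X a = a) :
    ∀ b : ℝ, a ≤ b → RCoeff X b = b := by
  intro b hab
  refine le_antisymm (by linarith [RCoeff_le_add (X := X) ha.le hab]) ?_
  rcases subsingleton_or_nontrivial X with _ | _
  · linarith [RCoeff_eq_zero_of_subsingleton (X := X) ha.le]
  obtain ⟨x, hx⟩ := exists_norm_eq X (ha.le.trans hab)
  exact hx.ge.trans (norm_le_RCoeff hx.le)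
end

section
/- Let X be a separable real Banach space. Then RW(1, X) ≤ J(X), where J(X) is the James constant of X. -/
open Filter Topology

/-- The coefficient `RW(a, X)` of García-Falset, Llorens-Fuster and Mazcuñán-Navarro. -/
noncomputable def RWCoeff (X : Type*) [NormedAddCommGroup X] [NormedSpace ℝ X] (a : ℝ) : ℝ :=
  sSup {r : ℝ | ∃ (x : X) (xs : ℕ → X), ‖x‖ ≤ a ∧ (∀ n, ‖xs n‖ ≤ 1) ∧
    (∀ f : X →L[ℝ] ℝ, Filter.Tendsto (fun n => f (xs n)) Filter.atTop (nhds 0)) ∧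
    r = min (Filter.liminf (fun n => ‖xs n + x‖) Filter.atTop)
            (Filter.liminf (fun n => ‖xs n - x‖) Filter.atTop)}

/-- The James constant `J(X)`. -/
noncomputable def JamesConst (X : Type*) [NormedAddCommGroup X] [NormedSpace ℝ X] : ℝ :=
  sSup {r : ℝ | ∃ x y : X, ‖x‖ ≤ 1 ∧ ‖y‖ ≤ 1 ∧ r = min ‖x + y‖ ‖x - y‖}

theorem bddAbove_jamesConst_set (X : Type*) [NormedAddCommGroup X] :
    BddAbove {r : ℝ | ∃ x y : X, ‖x‖ ≤ 1 ∧ ‖y‖ ≤ 1 ∧ r = min ‖x + y‖ ‖x - y‖} := by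
  refine ⟨2, ?_⟩
  rintro r ⟨x, y, hx, hy, rfl⟩
  exact (min_le_left _ _).trans ((norm_add_le x y).trans (by linarith))

theorem min_norm_le_jamesConst {X : Type*} [NormedAddCommGroup X] [NormedSpace ℝ X] {x y : X}
    (hx : ‖x‖ ≤ 1) (hy : ‖y‖ ≤ 1) : min ‖x + y‖ ‖x - y‖ ≤ JamesConst X :=
  le_csSup (bddAbove_jamesConst_set X) ⟨x, y, hx, hy, rfl⟩

theorem eventually_lt_norm_of_lt_liminf {X : Type*} [NormedAddCommGroup X] {u : ℕ → X} {c : ℝ}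
    (h : c < liminf (fun n => ‖u n‖) atTop) : ∀ᶠ n in atTop, c < ‖u n‖ :=
  eventually_lt_of_lt_liminf h (isBoundedUnder_of ⟨0, fun n => norm_nonneg (u n)⟩)

theorem stmt9 (X : Type*) [NormedAddCommGroup X] [NormedSpace ℝ X] [CompleteSpace X]
    [TopologicalSpace.SeparableSpace X] :
    RWCoeff X 1 ≤ JamesConst X := by
  refine csSup_le ⟨_, 0, fun _ => 0, by simp, by simp, by simp, rfl⟩ ?_
  rintro r ⟨x, xs, hx, hxs, -, rfl⟩
  by_contra! h
  obtain ⟨h₁, h₂⟩ := lt_min_iff.1 h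
  obtain ⟨n, hn₁, hn₂⟩ :=
    ((eventually_lt_norm_of_lt_liminf h₁).and (eventually_lt_norm_of_lt_liminf h₂)).exists
  exact (lt_min hn₁ hn₂).not_ge (min_norm_le_jamesConst (hxs n) hx)
end

section
/- Let X be a nonzero separable real Banach space. Then RW(1, X)² ≤ 2·C_NJ(X), where C_NJ(X) is the von Neumann–Jordan constant of X. -/
open Filter Topology

/-- The von Neumann–Jordan constant `C_NJ(X)`. -/
noncomputable def vNJConst (X : Type*) [NormedAddCommGroup X] [NormedSpace ℝ X] : ℝ :=
  sSup {r : ℝ | ∃ x y : X, (x ≠ 0 ∨ y ≠ 0) ∧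
    r = (‖x + y‖ ^ 2 + ‖x - y‖ ^ 2) / (2 * (‖x‖ ^ 2 + ‖y‖ ^ 2))}

/-- The parallelogram inequality with the von Neumann–Jordan constant. -/
theorem norm_add_sq_add_norm_sub_sq_le_vNJConst {X : Type*} [NormedAddCommGroup X]
    [NormedSpace ℝ X] (x y : X) :
    ‖x + y‖ ^ 2 + ‖x - y‖ ^ 2 ≤ vNJConst X * (2 * (‖x‖ ^ 2 + ‖y‖ ^ 2)) := by
  have pos : ∀ u v : X, (u ≠ 0 ∨ v ≠ 0) → 0 < 2 * (‖u‖ ^ 2 + ‖v‖ ^ 2) := by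
    rintro u v (h | h)
    · have := norm_pos_iff.mpr h
      positivity
    · have := norm_pos_iff.mpr h
      positivity
  by_cases h : x ≠ 0 ∨ y ≠ 0
  · rw [← div_le_iff₀ (pos x y h)]
    refine le_csSup ⟨2, ?_⟩ ⟨x, y, h, rfl⟩
    rintro _ ⟨u, v, huv, rfl⟩
    rw [div_le_iff₀ (pos u v huv)]
    have hadd := pow_le_pow_left₀ (norm_nonneg _) (norm_add_le u v) 2
    have hsub := pow_le_pow_left₀ (norm_nonneg _) (norm_sub_le u v) 2
    nlinarith [sq_nonneg (‖u‖ - ‖v‖)]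
  · push Not at h
    simp [h.1, h.2]

theorem vNJConst_nonneg (X : Type*) [NormedAddCommGroup X] [NormedSpace ℝ X] :
    0 ≤ vNJConst X := by
  refine Real.sSup_nonneg ?_
  rintro _ ⟨x, y, -, rfl⟩
  positivity

/-- The liminf of the norms of a bounded sequence is nonnegative. -/
theorem liminf_norm_nonneg {E : Type*} [SeminormedAddGroup E] {u : ℕ → E} {C : ℝ}
    (hu : ∀ n, ‖u n‖ ≤ C) : 0 ≤ liminf (fun n => ‖u n‖) atTop :=
  le_liminf_of_le
    (isBoundedUnder_of ⟨C, hu⟩ : IsBoundedUnder (· ≤ ·) atTop fun n => ‖u n‖).isCoboundedUnder_ge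
    (Eventually.of_forall fun _ => norm_nonneg _)

theorem RWCoeff_nonneg (X : Type*) [NormedAddCommGroup X] [NormedSpace ℝ X] (a : ℝ) :
    0 ≤ RWCoeff X a := by
  refine Real.sSup_nonneg ?_
  rintro _ ⟨x, xs, -, hxs, -, rfl⟩
  exact le_min
    (liminf_norm_nonneg fun n => (norm_add_le _ _).trans (add_le_add_left (hxs n) _))
    (liminf_norm_nonneg fun n => (norm_sub_le _ _).trans (add_le_add_left (hxs n) _))

theorem RWCoeff_one_le_sqrt (X : Type*) [NormedAddCommGroup X] [NormedSpace ℝ X] :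
    RWCoeff X 1 ≤ √(2 * vNJConst X) := by
  refine Real.sSup_le ?_ (Real.sqrt_nonneg _)
  rintro _ ⟨x, xs, hx, hxs, -, rfl⟩
  refine le_of_forall_lt_imp_le_of_dense fun c hc => ?_
  rcases le_or_gt c 0 with hc0 | hc0
  · exact hc0.trans (Real.sqrt_nonneg _)
  obtain ⟨n, hadd, hsub⟩ :=
    ((eventually_lt_of_lt_liminf (hc.trans_le (min_le_left _ _))
        (isBoundedUnder_of ⟨0, fun _ => norm_nonneg _⟩)).and
      (eventually_lt_of_lt_liminf (hc.trans_le (min_le_right _ _))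
        (isBoundedUnder_of ⟨0, fun _ => norm_nonneg _⟩))).exists
  apply Real.le_sqrt_of_sq_le
  have hadd2 := pow_le_pow_left₀ hc0.le hadd.le 2
  have hsub2 := pow_le_pow_left₀ hc0.le hsub.le 2
  have hx2 := pow_le_one₀ (n := 2) (norm_nonneg _) hx
  have hxs2 := pow_le_one₀ (n := 2) (norm_nonneg _) (hxs n)
  have hle : vNJConst X * (2 * (‖xs n‖ ^ 2 + ‖x‖ ^ 2)) ≤ vNJConst X * 4 :=
    mul_le_mul_of_nonneg_left (by linarith) (vNJConst_nonneg X)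
  linarith [norm_add_sq_add_norm_sub_sq_le_vNJConst (xs n) x]

theorem stmt10 (X : Type*) [NormedAddCommGroup X] [NormedSpace ℝ X] [CompleteSpace X]
    [TopologicalSpace.SeparableSpace X] [Nontrivial X] :
    (RWCoeff X 1) ^ 2 ≤ 2 * vNJConst X := by
  exact (Real.le_sqrt (RWCoeff_nonneg X 1)
    (mul_nonneg zero_le_two (vNJConst_nonneg X))).mp (RWCoeff_one_le_sqrt X)
end

section
/- Let X be a separable real Banach space. If X is uniformly nonsquare, then X has the fixed point property: every nonexpansive mapping of every nonempty closed bounded convex subset of X into itself has a fixed point. -/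
open Filter Topology

namespace UniformlyNonsquare

variable {ι X : Type*} [NormedAddCommGroup X] [NormedSpace ℝ X]

/-- Homogeneous form of uniform nonsquareness with constant `δ`. -/
def HasGap (X : Type*) [NormedAddCommGroup X] [NormedSpace ℝ X] (δ : ℝ) : Prop :=
  ∀ x y : X, min ‖(2⁻¹ : ℝ) • (x + y)‖ ‖(2⁻¹ : ℝ) • (x - y)‖ ≤ (1 - δ) * max ‖x‖ ‖y‖

lemma hasGap_of_unit_ball {δ : ℝ} (h : ∀ x y : X, ‖x‖ ≤ 1 → ‖y‖ ≤ 1 →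
    min (‖x + y‖ / 2) (‖x - y‖ / 2) ≤ 1 - δ) : HasGap X δ := by
  intro x y
  rcases (le_max_of_le_left (norm_nonneg x) : 0 ≤ max ‖x‖ ‖y‖).eq_or_lt with h0 | hpos
  · have hx : x = 0 := norm_le_zero_iff.1 (h0 ▸ le_max_left _ _)
    have hy : y = 0 := norm_le_zero_iff.1 (h0 ▸ le_max_right _ _)
    simp [hx, hy]
  · set r := max ‖x‖ ‖y‖
    have hscale : ∀ z : X, ‖r⁻¹ • z‖ = ‖z‖ / r := fun z => by
      rw [norm_smul, Real.norm_of_nonneg (by positivity), div_eq_inv_mul]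
    have hhalf : ∀ z : X, ‖(2⁻¹ : ℝ) • z‖ = ‖z‖ / 2 := fun z => by
      rw [norm_smul, Real.norm_of_nonneg (by positivity), div_eq_inv_mul]
    have key := h (r⁻¹ • x) (r⁻¹ • y)
      (by rw [hscale, div_le_one hpos]; exact le_max_left _ _)
      (by rw [hscale, div_le_one hpos]; exact le_max_right _ _)
    rw [← smul_add, ← smul_sub, hscale, hscale] at key
    rw [hhalf, hhalf, min_le_iff]
    rcases min_le_iff.1 key with h1 | h1
    · left
      rw [div_div, div_le_iff₀ (by positivity)] at h1
      linarith
    · right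
      rw [div_div, div_le_iff₀ (by positivity)] at h1
      linarith

/-- Limits of bounded real functions along an ultrafilter exist. -/
lemma tendsto_limUnder_of_abs_le {𝒰 : Ultrafilter ι} {g : ι → ℝ} {M : ℝ} (hg : ∀ i, |g i| ≤ M) :
    Tendsto g 𝒰 (𝓝 (limUnder (𝒰 : Filter ι) g)) := by
  have hmem : Set.Icc (-M) M ∈ (𝒰.map g : Filter ℝ) :=
    Filter.mem_map.2 (univ_mem' fun i => abs_le.1 (hg i))
  obtain ⟨a, -, ha⟩ := isCompact_Icc.ultrafilter_le_nhds (𝒰.map g) (le_principal_iff.2 hmem)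
  exact tendsto_nhds_limUnder ⟨a, ha⟩

/-- A bounded family of functionals converges pointwise along an ultrafilter. -/
lemma exists_dual_limit (𝒰 : Ultrafilter ι) {g : ι → StrongDual ℝ X} {R : ℝ}
    (hg : ∀ i, ‖g i‖ ≤ R) :
    ∃ f : StrongDual ℝ X, ∀ v, Tendsto (fun i => g i v) 𝒰 (𝓝 (f v)) := by
  have hb : ∀ v i, |g i v| ≤ R * ‖v‖ := fun v i => (g i).le_of_opNorm_le (hg i) v
  have ht : ∀ v, Tendsto (fun i => g i v) 𝒰 (𝓝 (limUnder (𝒰 : Filter ι) fun i => g i v)) :=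
    fun v => tendsto_limUnder_of_abs_le (hb v)
  let φ : X →ₗ[ℝ] ℝ :=
    { toFun := fun v => limUnder (𝒰 : Filter ι) fun i => g i v
      map_add' := fun v w => tendsto_nhds_unique (ht (v + w))
        (by simpa using (ht v).add (ht w))
      map_smul' := fun c v => tendsto_nhds_unique (ht (c • v))
        (by simpa using (ht v).const_mul c) }
  exact ⟨φ.mkContinuous R fun v => le_of_tendsto (ht v).norm (Eventually.of_forall (hb v)), ht⟩

/-- Weak convergence along a filter. -/
def TendstoWeakly (x : ι → X) (l : Filter ι) (x' : X) : Prop :=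
  ∀ f : StrongDual ℝ X, Tendsto (fun i => f (x i)) l (𝓝 (f x'))

lemma TendstoWeakly.mem {x : ι → X} {l : Filter ι} [l.NeBot] {x' : X}
    (h : TendstoWeakly x l x') {D : Set X} (hconv : Convex ℝ D) (hclosed : IsClosed D)
    (hD : ∀ᶠ i in l, x i ∈ D) : x' ∈ D := by
  by_contra hx'
  obtain ⟨f, u, hu, hf⟩ := geometric_hahn_banach_point_closed hconv hclosed hx'
  exact hu.not_ge (ge_of_tendsto (h f) (hD.mono fun i hi => (hf _ hi).le))

lemma TendstoWeakly.sub {x y : ι → X} {l : Filter ι} {x' y' : X}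
    (hx : TendstoWeakly x l x') (hy : TendstoWeakly y l y') :
    TendstoWeakly (fun i => x i - y i) l (x' - y') := fun f => by
  simpa using (hx f).sub (hy f)

lemma tendstoWeakly_const (l : Filter ι) (x' : X) : TendstoWeakly (fun _ => x') l x' :=
  fun _ => tendsto_const_nhds

lemma TendstoWeakly.norm_le {x : ι → X} {l : Filter ι} [l.NeBot] {x' : X}
    (h : TendstoWeakly x l x') {r : ℝ} (hr : ∀ᶠ i in l, ‖x i‖ ≤ r) : ‖x'‖ ≤ r := by
  simpa using h.mem (convex_closedBall 0 r) Metric.isClosed_closedBall (by simpa using hr)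

/-- The iterated limit along `𝒰` of `‖v + a₁ • x i₁ + ⋯ + aₖ • x iₖ‖`. -/
noncomputable def iterNorm (𝒰 : Ultrafilter ι) (x : ι → X) : List ℝ → X → ℝ
  | [], v => ‖v‖
  | a :: l, v => limUnder (𝒰 : Filter ι) fun i => iterNorm 𝒰 x l (v + a • x i)

section iterNorm

variable {𝒰 : Ultrafilter ι} {x : ι → X} {R : ℝ}

lemma iterNorm_bounds (hR : ∀ i, ‖x i‖ ≤ R) (l : List ℝ) (v : X) :
    0 ≤ iterNorm 𝒰 x l v ∧ iterNorm 𝒰 x l v ≤ ‖v‖ + R * (l.map abs).sum := by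
  induction l generalizing v with
  | nil => simp [iterNorm]
  | cons a l ih =>
    have hb : ∀ i, iterNorm 𝒰 x l (v + a • x i) ≤ ‖v‖ + R * ((a :: l).map abs).sum := fun i => by
      have h1 : ‖v + a • x i‖ ≤ ‖v‖ + |a| * R := by
        grw [norm_add_le, norm_smul, hR i, Real.norm_eq_abs]
      have h2 := (ih (v + a • x i)).2
      simp only [List.map_cons, List.sum_cons]
      linarith
    have ht := tendsto_limUnder_of_abs_le (𝒰 := 𝒰) (g := fun i => iterNorm 𝒰 x l (v + a • x i))
      fun i => (abs_of_nonneg (ih _).1).trans_le (hb i)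
    exact ⟨ge_of_tendsto ht (Eventually.of_forall fun i => (ih _).1),
      le_of_tendsto ht (Eventually.of_forall hb)⟩

lemma tendsto_iterNorm (hR : ∀ i, ‖x i‖ ≤ R) (a : ℝ) (l : List ℝ) (v : X) :
    Tendsto (fun i => iterNorm 𝒰 x l (v + a • x i)) 𝒰 (𝓝 (iterNorm 𝒰 x (a :: l) v)) := by
  refine tendsto_limUnder_of_abs_le (M := ‖v‖ + |a| * R + R * (l.map abs).sum) fun i => ?_
  obtain ⟨h0, h1⟩ := iterNorm_bounds (𝒰 := 𝒰) hR l (v + a • x i)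
  rw [abs_of_nonneg h0]
  have h2 : ‖v + a • x i‖ ≤ ‖v‖ + |a| * R := by
    grw [norm_add_le, norm_smul, hR i, Real.norm_eq_abs]
  linarith

lemma iterNorm_zero_cons (l : List ℝ) (v : X) :
    iterNorm 𝒰 x (0 :: l) v = iterNorm 𝒰 x l v := by
  simpa [iterNorm] using
    (tendsto_const_nhds (x := iterNorm 𝒰 x l v) (f := (𝒰 : Filter ι))).limUnder_eq

lemma iterNorm_zeros_append {α : Type*} (p : List α) (l : List ℝ) (v : X) :
    iterNorm 𝒰 x (p.map (fun _ => (0 : ℝ)) ++ l) v = iterNorm 𝒰 x l v := by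
  induction p with
  | nil => rfl
  | cons a p ih => simpa [iterNorm_zero_cons] using ih

lemma iterNorm_append_congr {l m : List ℝ} (h : ∀ v, iterNorm 𝒰 x l v = iterNorm 𝒰 x m v)
    (p : List ℝ) (v : X) : iterNorm 𝒰 x (p ++ l) v = iterNorm 𝒰 x (p ++ m) v := by
  induction p generalizing v with
  | nil => exact h v
  | cons a p ih => simp only [List.cons_append, iterNorm, ih]

lemma le_iterNorm_append (hR : ∀ i, ‖x i‖ ≤ R) {c : ℝ} {l : List ℝ}
    (h : ∀ v, c ≤ iterNorm 𝒰 x l v) (p : List ℝ) (v : X) : c ≤ iterNorm 𝒰 x (p ++ l) v := by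
  induction p generalizing v with
  | nil => exact h v
  | cons a p ih => exact ge_of_tendsto (tendsto_iterNorm hR a _ v) (Eventually.of_forall fun i => ih _)

lemma dual_le_iterNorm (hR : ∀ i, ‖x i‖ ≤ R) {f : StrongDual ℝ X} (hf : ‖f‖ ≤ 1) {t : ℝ}
    (ht : Tendsto (fun i => f (x i)) 𝒰 (𝓝 t)) (l : List ℝ) (v : X) :
    f v + l.sum * t ≤ iterNorm 𝒰 x l v := by
  induction l generalizing v with
  | nil =>
    simpa [iterNorm] using (le_abs_self _).trans (f.le_of_opNorm_le hf v)
  | cons a l ih =>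
    have h1 : Tendsto (fun i => f v + a * f (x i) + l.sum * t) 𝒰 (𝓝 (f v + a * t + l.sum * t)) :=
      ((ht.const_mul a).const_add (f v)).add_const _
    have h2 := le_of_tendsto_of_tendsto h1 (tendsto_iterNorm hR a l v)
      (Eventually.of_forall fun i => by simpa using ih (v + a • x i))
    simpa [add_mul, add_assoc] using h2

/-- The half-sum of a pair. -/
noncomputable def halfSum (p : ℝ × ℝ) : ℝ := (p.1 + p.2) / 2

/-- The half-difference of a pair. -/
noncomputable def halfDiff (p : ℝ × ℝ) : ℝ := (p.1 - p.2) / 2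

lemma HasGap.min_iterNorm_le {δ : ℝ} (hδ : HasGap X δ) (hR : ∀ i, ‖x i‖ ≤ R) (z : List (ℝ × ℝ))
    (v w : X) :
    min (iterNorm 𝒰 x (z.map halfSum) ((2⁻¹ : ℝ) • (v + w)))
        (iterNorm 𝒰 x (z.map halfDiff) ((2⁻¹ : ℝ) • (v - w))) ≤
      (1 - δ) * max (iterNorm 𝒰 x (z.map Prod.fst) v) (iterNorm 𝒰 x (z.map Prod.snd) w) := by
  induction z generalizing v w with
  | nil => exact hδ v w
  | cons p z ih =>
    refine le_of_tendsto_of_tendsto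
      ((tendsto_iterNorm hR (halfSum p) _ _).min (tendsto_iterNorm hR (halfDiff p) _ _))
      (((tendsto_iterNorm hR p.1 _ v).max (tendsto_iterNorm hR p.2 _ w)).const_mul _)
      (Eventually.of_forall fun i => ?_)
    have h1 : (2⁻¹ : ℝ) • (v + w) + halfSum p • x i =
        (2⁻¹ : ℝ) • (v + p.1 • x i + (w + p.2 • x i)) := by
      simp only [halfSum]; module
    have h2 : (2⁻¹ : ℝ) • (v - w) + halfDiff p • x i =
        (2⁻¹ : ℝ) • (v + p.1 • x i - (w + p.2 • x i)) := by
      simp only [halfDiff]; module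
    simpa only [h1, h2] using ih (v + p.1 • x i) (w + p.2 • x i)

end iterNorm

/-- `Alternates n s l` says that `l` has `n` successive tails whose sums are
`s, -s, s, …`. -/
def Alternates : ℕ → ℝ → List ℝ → Prop
  | 0, _, _ => True
  | n + 1, s, l => ∃ p t, l = p ++ t ∧ t.sum = s ∧ Alternates n (-s) t

lemma Alternates.append {n : ℕ} {s : ℝ} {l : List ℝ} (h : Alternates n s l) (p : List ℝ) :
    Alternates n s (p ++ l) := by
  cases n with
  | zero => trivial
  | succ n =>
    obtain ⟨q, t, rfl, ht⟩ := h
    exact ⟨p ++ q, t, (List.append_assoc ..).symm, ht⟩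

lemma exists_alternates (n : ℕ) (s : ℝ) (hs : |s| = 1) :
    ∃ l, Alternates n s l ∧ l.sum = -s ∧ (l.map abs).sum = 2 * n + 1 := by
  induction n generalizing s with
  | zero => exact ⟨[-s], trivial, by simp, by simp [hs]⟩
  | succ n ih =>
    obtain ⟨l, hl, hsum, habs⟩ := ih (-s) (by rwa [abs_neg])
    refine ⟨-2 * s :: l, ⟨[-2 * s], l, rfl, by rw [hsum, neg_neg], hl⟩, ?_, ?_⟩
    · rw [List.sum_cons, hsum]; ring
    · rw [List.map_cons, List.sum_cons, habs, abs_mul, hs]; norm_num; ring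

section reflexive

variable {𝒰 : Ultrafilter ι} {x : ι → X} {R : ℝ}

lemma sum_map_div_two (p : List ℝ) : (p.map fun a => a / 2).sum = p.sum / 2 := by
  induction p with
  | nil => simp
  | cons a p ih => simp [ih, add_div]

lemma exists_interlacing (n : ℕ) (s : ℝ) (l : List ℝ) (h : Alternates n s l) (hl : l.sum = -s) :
    ∃ z : List (ℝ × ℝ),
      (∀ v, iterNorm 𝒰 x (z.map Prod.fst) v = iterNorm 𝒰 x l v) ∧
      (∀ v, iterNorm 𝒰 x (z.map Prod.snd) v = iterNorm 𝒰 x l v) ∧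
      (z.map halfSum).sum = -s ∧ (z.map halfDiff).sum = 0 ∧
      Alternates n s (z.map halfSum) ∧ Alternates n s (z.map halfDiff) := by
  induction n generalizing s l with
  | zero =>
    refine ⟨l.map fun a => (a, a), ?_, ?_, ?_, ?_, trivial, trivial⟩ <;>
      simp [Function.comp_def, halfSum, halfDiff, hl]
  | succ n ih =>
    obtain ⟨p, t, rfl, ht, halt⟩ := h
    obtain ⟨z, hz1, hz2, hz3, hz4, hz5, hz6⟩ := ih (-s) t halt (by rw [ht, neg_neg])
    rw [neg_neg] at hz3
    rw [List.sum_append, ht] at hl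
    have hsum : (p.map (fun a => ((a, 0) : ℝ × ℝ)) ++
        (p.map (fun a => ((0, a) : ℝ × ℝ)) ++ z)).map halfSum =
        (p.map (fun a => a / 2) ++ p.map (fun a => a / 2)) ++ z.map halfSum := by
      simp [Function.comp_def, halfSum]
    have hdiff : (p.map (fun a => ((a, 0) : ℝ × ℝ)) ++
        (p.map (fun a => ((0, a) : ℝ × ℝ)) ++ z)).map halfDiff =
        p.map (fun a => a / 2) ++ ((p.map (fun a => -a)).map (fun a => a / 2) ++
          z.map halfDiff) := by
      simp [Function.comp_def, halfDiff]
    have hneg : (p.map (fun a => -a)).sum = -p.sum := (List.sum_neg p).symm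
    refine ⟨p.map (fun a => (a, 0)) ++ (p.map (fun a => (0, a)) ++ z), fun v => ?_, fun v => ?_,
      ?_, ?_, ?_, ?_⟩
    · simp only [List.map_append, List.map_map, Function.comp_def, List.map_id']
      exact iterNorm_append_congr (fun w => by rw [iterNorm_zeros_append, hz1]) p v
    · simp only [List.map_append, List.map_map, Function.comp_def, List.map_id']
      rw [iterNorm_zeros_append]
      exact iterNorm_append_congr hz2 p v
    · rw [hsum, List.sum_append, List.sum_append, sum_map_div_two, hz3]; linarith
    · rw [hdiff, List.sum_append, List.sum_append, sum_map_div_two, sum_map_div_two, hz4, hneg]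
      ring
    · rw [hsum]
      exact ⟨_, _, rfl, hz3, hz5⟩
    · rw [hdiff]
      refine ⟨_, _, rfl, ?_, hz6.append _⟩
      rw [List.sum_append, sum_map_div_two, hz4, hneg]
      linarith

/-- Norms of vectors alternating `n + 1` times grow at least geometrically in `n`. -/
lemma le_pow_mul_iterNorm {δ : ℝ} (hδ0 : 0 < δ) (hδ1 : δ < 1) (hδ : HasGap X δ)
    (hR : ∀ i, ‖x i‖ ≤ R) {θ : ℝ} (hθ : 0 < θ)
    (hlow : ∀ (l : List ℝ) (v : X), |l.sum| = 1 → θ ≤ iterNorm 𝒰 x l v) (n : ℕ) (s : ℝ)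
    (hs : |s| = 1) (l : List ℝ) (h : Alternates (n + 1) s l) :
    θ ≤ (1 - δ) ^ n * iterNorm 𝒰 x l 0 := by
  induction n generalizing s l with
  | zero =>
    obtain ⟨p, t, rfl, ht, -⟩ := h
    rw [pow_zero, one_mul]
    exact le_iterNorm_append hR (fun v => hlow t v (by rw [ht, hs])) p 0
  | succ n ih =>
    have hbase : ∀ m, Alternates (n + 2) s m → θ ≤ iterNorm 𝒰 x m 0 := fun m hm => by
      obtain ⟨p, t, rfl, ht, -⟩ := hm
      exact le_iterNorm_append hR (fun v => hlow t v (by rw [ht, hs])) p 0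
    by_contra! hlt
    have hstep : ∀ m, Alternates (n + 2) s m → (1 - δ) ^ (n + 1) * iterNorm 𝒰 x m 0 < θ →
        ∃ m', Alternates (n + 2) s m' ∧ iterNorm 𝒰 x m' 0 ≤ (1 - δ) * iterNorm 𝒰 x m 0 := by
      rintro m ⟨p, t, rfl, ht, hm⟩ hmlt
      obtain ⟨z, hz1, hz2, hz3, -, hz5, hz6⟩ :=
        exists_interlacing (𝒰 := 𝒰) (x := x) (n + 1) (-s) t hm (by rw [ht, neg_neg])
      have key := hδ.min_iterNorm_le (𝒰 := 𝒰) hR (p.map (fun a => (a, a)) ++ z) 0 0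
      simp only [List.map_append, List.map_map, Function.comp_def, List.map_id', add_zero,
        sub_zero, smul_zero, iterNorm_append_congr hz1, iterNorm_append_congr hz2,
        max_self] at key
      rcases min_le_iff.1 key with h1 | h1
      · exact ⟨_, ⟨_, _, rfl, by rw [hz3, neg_neg], hz5⟩, h1⟩
      · have h2 := ih (-s) (by rwa [abs_neg]) _ (hz6.append (p.map fun a => halfDiff (a, a)))
        have h3 : (0 : ℝ) ≤ (1 - δ) ^ n := pow_nonneg (by linarith) n
        have h4 := mul_le_mul_of_nonneg_left h1 h3
        rw [pow_succ, mul_assoc] at hmlt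
        linarith
    have hiter : ∀ k : ℕ, ∃ m, Alternates (n + 2) s m ∧
        iterNorm 𝒰 x m 0 ≤ (1 - δ) ^ k * iterNorm 𝒰 x l 0 := fun k => by
      induction k with
      | zero => exact ⟨l, h, by simp⟩
      | succ k ihk =>
        obtain ⟨m, hm, hmk⟩ := ihk
        have hl0 : 0 ≤ iterNorm 𝒰 x l 0 := (iterNorm_bounds hR l 0).1
        have hle : iterNorm 𝒰 x m 0 ≤ iterNorm 𝒰 x l 0 :=
          hmk.trans (mul_le_of_le_one_left hl0 (pow_le_one₀ (by linarith) (by linarith)))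
        obtain ⟨m', hm', hle'⟩ := hstep m hm (lt_of_le_of_lt
          (mul_le_mul_of_nonneg_left hle (pow_nonneg (by linarith) _)) hlt)
        refine ⟨m', hm', hle'.trans ?_⟩
        rw [pow_succ', mul_assoc]
        exact mul_le_mul_of_nonneg_left hmk (by linarith)
    have hlim : Tendsto (fun k : ℕ => (1 - δ) ^ k * iterNorm 𝒰 x l 0) atTop (𝓝 0) := by
      simpa using (tendsto_pow_atTop_nhds_zero_of_lt_one (r := 1 - δ) (by linarith)
        (by linarith)).mul_const (iterNorm 𝒰 x l 0)
    refine hθ.not_ge (ge_of_tendsto hlim (Eventually.of_forall fun k => ?_))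
    obtain ⟨m, hm, hmk⟩ := hiter k
    exact (hbase m hm).trans hmk

/-- Bounded families in a uniformly nonsquare Banach space have weak limits along ultrafilters:
such a space is reflexive. -/
theorem exists_tendstoWeakly [CompleteSpace X] {δ : ℝ} (hδ0 : 0 < δ) (hδ1 : δ < 1)
    (hδ : HasGap X δ) (𝒰 : Ultrafilter ι) {x : ι → X} {R : ℝ} (hR : ∀ i, ‖x i‖ ≤ R) :
    ∃ x', TendstoWeakly x 𝒰 x' := by
  let J := NormedSpace.inclusionInDoubleDualLi (E := X) ℝ
  obtain ⟨F, hF⟩ := exists_dual_limit 𝒰 (g := fun i => J (x i)) (R := R)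
    fun i => (J.norm_map (x i)).trans_le (hR i)
  have hF' : ∀ f : StrongDual ℝ X, Tendsto (fun i => f (x i)) 𝒰 (𝓝 (F f)) := hF
  by_cases hmem : F ∈ Set.range J
  · obtain ⟨x', rfl⟩ := hmem
    exact ⟨x', hF'⟩
  exfalso
  have hclosed : IsClosed (Set.range J) :=
    J.isometry.isUniformInducing.isComplete_range.isClosed
  set θ := Metric.infDist F (Set.range J)
  have hθ : 0 < θ := (hclosed.notMem_iff_infDist_pos (Set.range_nonempty _)).1 hmem
  have hlow : ∀ (l : List ℝ) (v : X), |l.sum| = 1 → θ ≤ iterNorm 𝒰 x l v := by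
    intro l v hl
    refine (Metric.infDist_le_dist_of_mem (Set.mem_range_self (-(l.sum • v)))).trans ?_
    rw [dist_eq_norm]
    refine ContinuousLinearMap.opNorm_le_of_unit_norm (iterNorm_bounds hR l v).1 fun f hf => ?_
    have h1 := dual_le_iterNorm hR hf.le (hF' f) l v
    have h2 := dual_le_iterNorm (𝒰 := 𝒰) hR (f := -f) (t := -F f) (by rw [norm_neg, hf])
      ((hF' f).neg) l v
    change f v + _ ≤ _ at h1
    change -f v + _ ≤ _ at h2
    change |F f - f (-(l.sum • v))| ≤ _
    rw [map_neg, map_smul, smul_eq_mul, abs_le']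
    rcases (abs_eq zero_le_one).1 hl with hs | hs <;> rw [hs] at h1 h2 ⊢ <;>
      constructor <;> linarith
  have hlim : Tendsto (fun n : ℕ => (1 - δ) ^ n * (R * (2 * (n + 1 : ℕ) + 1))) atTop (𝓝 0) := by
    have h1 := tendsto_self_mul_const_pow_of_lt_one (r := 1 - δ) (by linarith) (by linarith)
    have h2 := tendsto_pow_atTop_nhds_zero_of_lt_one (r := 1 - δ) (by linarith) (by linarith)
    have h3 := (h1.const_mul (2 * R)).add (h2.const_mul (3 * R))
    simp only [mul_zero, add_zero] at h3
    refine h3.congr fun n => ?_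
    push_cast
    ring
  refine hθ.not_ge (ge_of_tendsto hlim (Eventually.of_forall fun n => ?_))
  obtain ⟨l, hl, -, habs⟩ := exists_alternates (n + 1) 1 abs_one
  have h1 := le_pow_mul_iterNorm hδ0 hδ1 hδ hR hθ hlow n 1 abs_one l hl
  have h2 := (iterNorm_bounds (𝒰 := 𝒰) hR l 0).2
  rw [norm_zero, zero_add, habs] at h2
  exact h1.trans (mul_le_mul_of_nonneg_left h2 (pow_nonneg (by linarith) n))

end reflexive

/-- A nonempty closed convex set left invariant by `T`. -/
structure IsInvariant (T : X → X) (D : Set X) : Prop where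
  nonempty : D.Nonempty
  isClosed : IsClosed D
  convex : Convex ℝ D
  mapsTo : Set.MapsTo T D D

/-- Invariant subsets of a bounded set contain minimal ones if bounded families have weak
limits. -/
lemma exists_minimal_isInvariant [CompleteSpace X] {δ : ℝ} (hδ0 : 0 < δ) (hδ1 : δ < 1)
    (hδ : HasGap X δ) {T : X → X} {C : Set X} (hC : IsInvariant T C)
    (hbdd : Bornology.IsBounded C) :
    ∃ K ⊆ C, Minimal (IsInvariant T) K := by
  obtain ⟨R, hR⟩ := hbdd.exists_norm_le
  obtain ⟨K, hK, hmin⟩ := zorn_superset_nonempty {D | D ⊆ C ∧ IsInvariant T D}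
    (fun c hc hchain hne => by
      obtain ⟨D₀, hD₀⟩ := hne
      have : Nonempty c := ⟨⟨D₀, hD₀⟩⟩
      let l : Filter C := ⨅ D : c, 𝓟 (Subtype.val ⁻¹' (D : Set X))
      have hl : l.NeBot := by
        refine iInf_neBot_of_directed' ?_ fun D => ?_
        · intro D E
          rcases hchain.total D.2 E.2 with h | h
          · exact ⟨D, le_rfl, principal_mono.2 (Set.preimage_mono h)⟩
          · exact ⟨E, principal_mono.2 (Set.preimage_mono h), le_rfl⟩
        · obtain ⟨y, hy⟩ := (hc D.2).2.nonempty
          exact principal_neBot_iff.2 ⟨⟨y, (hc D.2).1 hy⟩, hy⟩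
      obtain ⟨x', hx'⟩ := exists_tendstoWeakly hδ0 hδ1 hδ (Ultrafilter.of l)
        (x := Subtype.val) (R := R) fun y => hR y y.2
      have hmem : ∀ D ∈ c, x' ∈ D := fun D hD =>
        hx'.mem (hc hD).2.convex (hc hD).2.isClosed
          (Ultrafilter.of_le l (mem_iInf_of_mem ⟨D, hD⟩ (mem_principal_self _)))
      exact ⟨⋂₀ c, ⟨(Set.sInter_subset_of_mem hD₀).trans (hc hD₀).1, ⟨x', hmem⟩,
        isClosed_sInter fun D hD => (hc hD).2.isClosed,
        convex_sInter fun D hD => (hc hD).2.convex,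
        fun y hy D hD => (hc hD).2.mapsTo (hy D hD)⟩,
        fun D hD => Set.sInter_subset_of_mem hD⟩)
    C ⟨subset_rfl, hC⟩
  exact ⟨K, hK, hmin.prop.2, fun D hD hle => hmin.le_of_le ⟨hle.trans hK, hD⟩ hle⟩

section minimal

variable {T : X → X} {K : Set X}

lemma diam_le_of_subset_closedBall (hK : Minimal (IsInvariant T) K)
    (hT : ∀ x ∈ K, ∀ y ∈ K, ‖T x - T y‖ ≤ ‖x - y‖) {x : X} (hx : x ∈ K) {r : ℝ} (hr : 0 ≤ r)
    (h : ∀ y ∈ K, ‖y - x‖ ≤ r) : Metric.diam K ≤ r := by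
  have hball : ∀ z ∈ K, (∀ y ∈ K, ‖y - z‖ ≤ r) → ∀ y ∈ K, ‖y - T z‖ ≤ r := by
    intro z hz hzr
    have hTz : Set.MapsTo T K (K ∩ Metric.closedBall (T z) r) := fun y hy =>
      ⟨hK.prop.mapsTo hy, mem_closedBall_iff_norm.2 ((hT y hy z hz).trans (hzr y hy))⟩
    have hinv : IsInvariant T (K ∩ Metric.closedBall (T z) r) :=
      ⟨⟨_, hTz hz⟩, hK.prop.isClosed.inter Metric.isClosed_closedBall,
        hK.prop.convex.inter (convex_closedBall _ _), hTz.mono_left Set.inter_subset_left⟩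
    exact fun y hy =>
      mem_closedBall_iff_norm.1 (hK.le_of_le hinv Set.inter_subset_left hy).2
  have hinv : IsInvariant T (K ∩ ⋂ y ∈ K, Metric.closedBall y r) := by
    refine ⟨⟨x, hx, ?_⟩, hK.prop.isClosed.inter
      (isClosed_biInter fun _ _ => Metric.isClosed_closedBall),
      hK.prop.convex.inter (convex_iInter₂ fun _ _ => convex_closedBall _ _), ?_⟩
    · simpa [dist_eq_norm, norm_sub_rev x] using h
    · rintro z ⟨hz, hzr⟩
      refine ⟨hK.prop.mapsTo hz, ?_⟩
      simp only [Set.mem_iInter, mem_closedBall_iff_norm'] at hzr ⊢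
      exact hball z hz hzr
  refine Metric.diam_le_of_forall_dist_le hr fun y hy z hz => ?_
  have := (hK.le_of_le hinv Set.inter_subset_left hy).2
  simp only [Set.mem_iInter] at this
  exact this z hz

/-- The Goebel–Karlovitz lemma: almost fixed points of a nonexpansive map on a minimal invariant
set are almost diametral. -/
lemma diam_sub_lt_of_almost_fixed [CompleteSpace X] {δ : ℝ} (hδ0 : 0 < δ) (hδ1 : δ < 1)
    (hδ : HasGap X δ) (hK : Minimal (IsInvariant T) K)
    (hT : ∀ x ∈ K, ∀ y ∈ K, ‖T x - T y‖ ≤ ‖x - y‖) (hbdd : Bornology.IsBounded K) {x : X}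
    (hx : x ∈ K) {η : ℝ} (hη : 0 < η) :
    ∃ ε > 0, ∀ y ∈ K, ‖T y - y‖ ≤ ε → Metric.diam K - η < ‖y - x‖ := by
  obtain ⟨R, hR⟩ := hbdd.exists_norm_le
  by_contra! hcon
  choose y hyK hyT hyx using fun n : ℕ => hcon (1 / ((n : ℝ) + 1)) Nat.one_div_pos_of_nat
  have hlim : Tendsto (fun n => ‖T (y n) - y n‖) atTop (𝓝 0) :=
    squeeze_zero (fun _ => norm_nonneg _) hyT tendsto_one_div_add_atTop_nhds_zero_nat
  set r := Metric.diam K - η with hr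
  have hr0 : 0 ≤ r := (norm_nonneg _).trans (hyx 0)
  have hinv : IsInvariant T (K ∩ {z | ∀ ρ > r, ∀ᶠ n in atTop, ‖y n - z‖ ≤ ρ}) := by
    refine ⟨⟨x, hx, fun ρ hρ => Eventually.of_forall fun n => (hyx n).trans hρ.le⟩,
      hK.prop.isClosed.inter ?_, hK.prop.convex.inter ?_, ?_⟩
    · refine isClosed_of_closure_subset fun z hz ρ hρ => ?_
      obtain ⟨w, hw, hzw⟩ := Metric.mem_closure_iff.1 hz ((ρ - r) / 2) (by linarith)
      filter_upwards [hw (r + (ρ - r) / 2) (by linarith)] with n hn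
      have h1 := norm_sub_le_norm_sub_add_norm_sub (y n) w z
      rw [dist_comm, dist_eq_norm] at hzw
      linarith
    · intro z hz w hw a b ha hb hab ρ hρ
      filter_upwards [hz ρ hρ, hw ρ hρ] with n hn hn'
      have h1 := convex_closedBall (y n) ρ (mem_closedBall_iff_norm'.2 hn)
        (mem_closedBall_iff_norm'.2 hn') ha hb hab
      exact mem_closedBall_iff_norm'.1 h1
    · rintro z ⟨hz, hzr⟩
      refine ⟨hK.prop.mapsTo hz, fun ρ hρ => ?_⟩
      filter_upwards [hzr (r + (ρ - r) / 2) (by linarith),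
        hlim.eventually_le_const (show 0 < (ρ - r) / 2 by linarith)] with n hn hn'
      have h1 := norm_sub_le_norm_sub_add_norm_sub (y n) (T (y n)) (T z)
      have h2 := hT _ (hyK n) z hz
      rw [norm_sub_rev (y n) (T (y n))] at h1
      linarith
  obtain ⟨y', hy'⟩ := exists_tendstoWeakly hδ0 hδ1 hδ (hyperfilter ℕ) fun n => hR _ (hyK n)
  have hle : ((hyperfilter ℕ : Ultrafilter ℕ) : Filter ℕ) ≤ atTop := Nat.hyperfilter_le_atTop
  have hy'K : y' ∈ K := hy'.mem hK.prop.convex hK.prop.isClosed (Eventually.of_forall hyK)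
  have hdiam : Metric.diam K ≤ r + η / 2 := by
    refine diam_le_of_subset_closedBall hK hT hy'K (by linarith) fun z hz => ?_
    rw [norm_sub_rev]
    exact (hy'.sub (tendstoWeakly_const _ z)).norm_le
      (hle ((hK.le_of_le hinv Set.inter_subset_left hz).2 _ (by linarith)))
  linarith

end minimal

/-- Points of a closed convex set solve `w = (1 - ε) T w + ε p` for nonexpansive self-maps `T`. -/
lemma exists_eq_smul_add [CompleteSpace X] {T : X → X} {K : Set X} (hK : IsInvariant T K)
    (hT : ∀ x ∈ K, ∀ y ∈ K, ‖T x - T y‖ ≤ ‖x - y‖) {p : X} (hp : p ∈ K) {ε : ℝ} (hε0 : 0 < ε)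
    (hε1 : ε < 1) : ∃ w ∈ K, w = (1 - ε) • T w + ε • p := by
  have hmaps : Set.MapsTo (fun w => (1 - ε) • T w + ε • p) K K := fun w hw =>
    hK.convex (hK.mapsTo hw) hp (by linarith) hε0.le (by ring)
  have hcontr : ContractingWith (Real.toNNReal (1 - ε)) (hmaps.restrict _ K K) := by
    refine ⟨by rw [Real.toNNReal_lt_one]; linarith, LipschitzWith.of_dist_le_mul fun v w => ?_⟩
    rw [Real.coe_toNNReal _ (by linarith), Subtype.dist_eq, Subtype.dist_eq, dist_eq_norm,
      dist_eq_norm]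
    simp only [Set.MapsTo.val_restrict_apply, add_sub_add_right_eq_sub, ← smul_sub]
    rw [norm_smul, Real.norm_of_nonneg (by linarith)]
    exact mul_le_mul_of_nonneg_left (hT _ v.2 _ w.2) (by linarith)
  obtain ⟨w, hw, hfix, -⟩ := hcontr.exists_fixedPoint' hK.isClosed.isComplete hmaps hp
    (edist_ne_top _ _)
  exact ⟨w, hw, hfix.symm⟩

section approx

variable {T : X → X} {K : Set X} {ε : ℝ}

lemma norm_map_sub_le (hε0 : 0 < ε) (hK : Bornology.IsBounded K) {w p : X}
    (hTw : T w ∈ K) (hp : p ∈ K) (hw : w = (1 - ε) • T w + ε • p) :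
    ‖T w - w‖ ≤ ε * Metric.diam K := by
  have h : T w - w = ε • (T w - p) :=
    (congrArg (T w - ·) hw).trans (by module)
  rw [h, norm_smul, Real.norm_of_nonneg hε0.le, ← dist_eq_norm]
  exact mul_le_mul_of_nonneg_left (Metric.dist_le_diam_of_mem hK hTw hp) hε0.le

lemma norm_sub_le_of_eq_smul_add (hε0 : 0 < ε) (hε1 : ε < 1)
    (hT : ∀ x ∈ K, ∀ y ∈ K, ‖T x - T y‖ ≤ ‖x - y‖) {v w p q : X} (hv : v ∈ K) (hw : w ∈ K)
    (hvp : v = (1 - ε) • T v + ε • p) (hwq : w = (1 - ε) • T w + ε • q) :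
    ‖v - w‖ ≤ ‖p - q‖ := by
  have h : v - w = (1 - ε) • (T v - T w) + ε • (p - q) := by
    conv_lhs => rw [hvp, hwq]
    module
  have h1 : ‖v - w‖ ≤ (1 - ε) * ‖v - w‖ + ε * ‖p - q‖ := by
    calc ‖v - w‖ ≤ ‖(1 - ε) • (T v - T w)‖ + ‖ε • (p - q)‖ := by rw [h]; exact norm_add_le _ _
      _ = (1 - ε) * ‖T v - T w‖ + ε * ‖p - q‖ := by
        rw [norm_smul, norm_smul, Real.norm_of_nonneg hε0.le, Real.norm_of_nonneg (by linarith)]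
      _ ≤ _ := by
        have := mul_le_mul_of_nonneg_left (hT v hv w hw) (show 0 ≤ 1 - ε by linarith)
        linarith
  nlinarith

lemma norm_sub_le_add_div (hε0 : 0 < ε) (hε1 : ε < 1)
    (hT : ∀ x ∈ K, ∀ y ∈ K, ‖T x - T y‖ ≤ ‖x - y‖) {w x p : X} (hw : w ∈ K) (hx : x ∈ K)
    (hwp : w = (1 - ε) • T w + ε • p) :
    ‖w - x‖ ≤ ‖p - x‖ + ‖T x - x‖ / ε := by
  have h : w - x = (1 - ε) • (T w - T x) + (1 - ε) • (T x - x) + ε • (p - x) := by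
    conv_lhs => rw [hwp]
    module
  have h1 : ‖w - x‖ ≤ (1 - ε) * ‖w - x‖ + ‖T x - x‖ + ε * ‖p - x‖ := by
    calc ‖w - x‖ ≤ ‖(1 - ε) • (T w - T x)‖ + ‖(1 - ε) • (T x - x)‖ + ‖ε • (p - x)‖ := by
          rw [h]; exact norm_add₃_le
      _ = (1 - ε) * ‖T w - T x‖ + (1 - ε) * ‖T x - x‖ + ε * ‖p - x‖ := by
        rw [norm_smul, norm_smul, norm_smul, Real.norm_of_nonneg hε0.le,
          Real.norm_of_nonneg (by linarith)]
      _ ≤ _ := by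
        have h2 := mul_le_mul_of_nonneg_left (hT w hw x hx) (show 0 ≤ 1 - ε by linarith)
        have h3 := mul_nonneg hε0.le (norm_nonneg (T x - x))
        linarith
  rw [← sub_le_iff_le_add', le_div_iff₀ hε0]
  linarith

end approx

/-- If `u` is weakly null and `‖u n + v‖ > c` for all `n`, then some `u n - u m ± v` both have norm
almost `c`. -/
lemma exists_lt_norm_sub_add {𝒰 : Ultrafilter ι} {u : ι → X} {v : X} {c η : ℝ} (hη : 0 < η)
    (hu : TendstoWeakly u 𝒰 0) (huv : ∀ n, c < ‖u n + v‖) :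
    ∃ m n, c - η < ‖u n - u m + v‖ ∧ c - η < ‖u n - u m - v‖ := by
  choose f hf hfu using fun n => exists_dual_vector'' ℝ (u n + v)
  have hle : ∀ n z, f n z ≤ ‖z‖ := fun n z => by
    simpa using (le_abs_self _).trans ((f n).le_of_opNorm_le (hf n) z)
  have hle' : ∀ n z, -f n z ≤ ‖z‖ := fun n z => by
    simpa using hle n (-z)
  obtain ⟨g, hg⟩ := exists_dual_limit 𝒰 hf
  have hgu : ∀ᶠ m in (𝒰 : Filter ι), g (u m) < η :=
    (hu g).eventually_lt_const (by simpa using hη)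
  obtain ⟨m, hm⟩ := hgu.exists
  obtain ⟨n, hn1, hn2⟩ := (((hg (u m)).eventually_lt_const hm).and
    ((hu (f m)).eventually_lt_const (show f m 0 < η by simpa using hη))).exists
  have hsplit : ∀ k, c < f k (u k) + f k v := fun k => by
    rw [← map_add, hfu]; exact huv k
  refine ⟨m, n, ?_, ?_⟩
  · have h1 := hle n (u n - u m + v)
    rw [map_add, map_sub] at h1
    linarith [hsplit n]
  · have h1 := hle' m (u n - u m - v)
    rw [map_sub, map_sub] at h1
    linarith [hsplit m]

/-- A minimal invariant set of a nonexpansive map on a uniformly nonsquare Banach space is a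
singleton. -/
theorem diam_eq_zero_of_minimal [CompleteSpace X] {δ : ℝ} (hδ0 : 0 < δ) (hδ1 : δ < 1)
    (hδ : HasGap X δ) {T : X → X} {K : Set X} (hK : Minimal (IsInvariant T) K)
    (hT : ∀ x ∈ K, ∀ y ∈ K, ‖T x - T y‖ ≤ ‖x - y‖) (hbdd : Bornology.IsBounded K) :
    Metric.diam K = 0 := by
  by_contra hne
  set d := Metric.diam K
  have hd : 0 < d := Metric.diam_nonneg.lt_of_ne' hne
  obtain ⟨R, hR⟩ := hbdd.exists_norm_le
  have hinv := hK.prop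
  obtain ⟨p₀, hp₀⟩ := hinv.nonempty
  have hle : ((hyperfilter ℕ : Ultrafilter ℕ) : Filter ℕ) ≤ atTop := Nat.hyperfilter_le_atTop
  have happrox : ∀ n : ℕ, ∃ x ∈ K, ‖T x - x‖ ≤ 1 / ((n : ℝ) + 1) * d := fun n => by
    have h0 : (0 : ℝ) < 1 / ((n : ℝ) + 1 + 1) := by positivity
    obtain ⟨x, hx, hxT⟩ := exists_eq_smul_add hinv hT hp₀ h0
      (by rw [div_lt_one (by positivity)]; linarith [(n.cast_nonneg : (0 : ℝ) ≤ n)])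
    refine ⟨x, hx, (norm_map_sub_le h0 hbdd (hinv.mapsTo hx) hp₀ hxT).trans ?_⟩
    have : (1 : ℝ) / ((n : ℝ) + 1 + 1) ≤ 1 / ((n : ℝ) + 1) :=
      one_div_le_one_div_of_le (by positivity) (by linarith)
    exact mul_le_mul_of_nonneg_right this hd.le
  choose x hxK hxT using happrox
  have hxlim : Tendsto (fun n => ‖T (x n) - x n‖) atTop (𝓝 0) :=
    squeeze_zero (fun _ => norm_nonneg _) hxT
      (by simpa using tendsto_one_div_add_atTop_nhds_zero_nat.mul_const d)
  obtain ⟨x', hx'⟩ := exists_tendstoWeakly hδ0 hδ1 hδ (hyperfilter ℕ) fun n => hR _ (hxK n)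
  have hx'K : x' ∈ K := hx'.mem hinv.convex hinv.isClosed (Eventually.of_forall hxK)
  set η := δ * d / 2 with hηdef
  have hη : 0 < η := by positivity
  obtain ⟨ε₀, hε₀, hfar⟩ := diam_sub_lt_of_almost_fixed hδ0 hδ1 hδ hK hT hbdd hx'K hη
  obtain ⟨ε, hε0, hε⟩ := exists_between (show 0 < min 1 (ε₀ / d) by positivity)
  have hε1 : ε < 1 := hε.trans_le (min_le_left _ _)
  have hεd : ε * d ≤ ε₀ := ((lt_div_iff₀ hd).1 (hε.trans_le (min_le_right _ _))).le
  have hmid : ∀ n, midpoint ℝ x' (x n) ∈ K := fun n => hinv.convex.midpoint_mem hx'K (hxK n)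
  choose w hwK hw using fun n => exists_eq_smul_add hinv hT (hmid n) hε0 hε1
  obtain ⟨w', hw'⟩ := exists_tendstoWeakly hδ0 hδ1 hδ (hyperfilter ℕ) fun n => hR _ (hwK n)
  have hwx' : ∀ n, d - η < ‖w n - w' + (w' - x')‖ := fun n => by
    rw [sub_add_sub_cancel]
    exact hfar _ (hwK n)
      ((norm_map_sub_le hε0 hbdd (hinv.mapsTo (hwK n)) (hmid n) (hw n)).trans hεd)
  have hww : ∀ m n, ‖w n - w m‖ ≤ d / 2 := fun m n => by
    refine (norm_sub_le_of_eq_smul_add hε0 hε1 hT (hwK n) (hwK m) (hw n) (hw m)).trans ?_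
    have h1 := Metric.dist_le_diam_of_mem hbdd (hxK n) (hxK m)
    have h2 : midpoint ℝ x' (x n) - midpoint ℝ x' (x m) = (2⁻¹ : ℝ) • (x n - x m) := by
      rw [midpoint_eq_smul_add, midpoint_eq_smul_add, invOf_eq_inv]; module
    rw [h2, norm_smul, Real.norm_of_nonneg (by norm_num), ← dist_eq_norm]
    linarith
  have hwx : ∀ n, ‖w n - x n‖ ≤ d / 2 + ‖T (x n) - x n‖ / ε := fun n => by
    refine (norm_sub_le_add_div hε0 hε1 hT (hwK n) (hxK n) (hw n)).trans ?_
    have h1 := Metric.dist_le_diam_of_mem hbdd hx'K (hxK n)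
    have h2 : midpoint ℝ x' (x n) - x n = (2⁻¹ : ℝ) • (x' - x n) := by
      rw [midpoint_eq_smul_add, invOf_eq_inv]; module
    rw [h2, norm_smul, Real.norm_of_nonneg (by norm_num), ← dist_eq_norm]
    linarith
  have hv : ‖w' - x'‖ ≤ d / 2 := by
    refine le_of_forall_pos_le_add fun ρ hρ => (hw'.sub hx').norm_le ?_
    refine hle ?_
    filter_upwards [hxlim.eventually_le_const (show 0 < ε * ρ by positivity)] with n hn
    have h1 : ‖T (x n) - x n‖ / ε ≤ ρ := by rwa [div_le_iff₀' hε0]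
    linarith [hwx n]
  obtain ⟨m, n, hadd, hsub⟩ := exists_lt_norm_sub_add hη
    (by simpa using hw'.sub (tendstoWeakly_const _ w')) hwx'
  rw [sub_sub_sub_cancel_right] at hadd hsub
  have key := hδ (w n - w m) (w' - x')
  rw [norm_smul, norm_smul, Real.norm_of_nonneg (by norm_num)] at key
  have hmax : (1 - δ) * max ‖w n - w m‖ ‖w' - x'‖ ≤ (1 - δ) * (d / 2) :=
    mul_le_mul_of_nonneg_left (max_le (hww m n) hv) (by linarith)
  rcases min_le_iff.1 key with h | h <;> linarith

end UniformlyNonsquare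

theorem stmt11 (X : Type*) [NormedAddCommGroup X] [NormedSpace ℝ X] [CompleteSpace X]
    [TopologicalSpace.SeparableSpace X]
    (hUNS : ∃ δ : ℝ, 0 < δ ∧ δ < 1 ∧ ∀ x y : X, ‖x‖ ≤ 1 → ‖y‖ ≤ 1 →
      min (‖x + y‖ / 2) (‖x - y‖ / 2) ≤ 1 - δ) :
    ∀ C : Set X, C.Nonempty → IsClosed C → Bornology.IsBounded C → Convex ℝ C →
      ∀ T : X → X, Set.MapsTo T C C →
        (∀ x ∈ C, ∀ y ∈ C, ‖T x - T y‖ ≤ ‖x - y‖) →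
        ∃ x ∈ C, T x = x := by
  obtain ⟨δ, hδ0, hδ1, hδ⟩ := hUNS
  intro C hne hclosed hbdd hconv T hmaps hT
  have hgap := UniformlyNonsquare.hasGap_of_unit_ball hδ
  obtain ⟨K, hKC, hK⟩ := UniformlyNonsquare.exists_minimal_isInvariant hδ0 hδ1 hgap
    ⟨hne, hclosed, hconv, hmaps⟩ hbdd
  have hdiam := UniformlyNonsquare.diam_eq_zero_of_minimal hδ0 hδ1 hgap hK
    (fun x hx y hy => hT x (hKC hx) y (hKC hy)) (hbdd.subset hKC)
  obtain ⟨x, hx⟩ := hK.prop.nonempty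
  have hdist := Metric.dist_le_diam_of_mem (hbdd.subset hKC) (hK.prop.mapsTo hx) hx
  exact ⟨x, hKC hx, dist_le_zero.1 (hdiam ▸ hdist)⟩
end

section
/- Let X be a separable real Banach space with RW(1, X) = 1 that satisfies the nonstrict Opial condition. Then X has property(m∞): for every sequence (xₙ) in X converging weakly to 0 and every x ∈ X, limsup_{n→∞} ‖xₙ + x‖ = max( limsup_{n→∞} ‖xₙ‖, ‖x‖ ). -/
open Filter Topology

section WeaklyNull

variable {X : Type*} [NormedAddCommGroup X] [NormedSpace ℝ X]

/-- A sequence converging weakly to `0`. -/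
def WeaklyNull (z : ℕ → X) : Prop :=
  ∀ f : X →L[ℝ] ℝ, Tendsto (fun n => f (z n)) atTop (𝓝 0)

/-- The nonstrict Opial condition. -/
def NonstrictOpial (X : Type*) [NormedAddCommGroup X] [NormedSpace ℝ X] : Prop :=
  ∀ (z : ℕ → X) (x : X), WeaklyNull z →
    limsup (fun n => ‖z n‖) atTop ≤ limsup (fun n => ‖z n + x‖) atTop

theorem WeaklyNull.const_smul {z : ℕ → X} (hz : WeaklyNull z) (a : ℝ) :
    WeaklyNull (fun n => a • z n) := fun f => by
  simpa using (hz f).const_mul a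

theorem WeaklyNull.comp_tendsto {z : ℕ → X} (hz : WeaklyNull z) {φ : ℕ → ℕ}
    (hφ : Tendsto φ atTop atTop) : WeaklyNull (fun n => z (φ n)) :=
  fun f => (hz f).comp hφ

theorem WeaklyNull.add {z z' : ℕ → X} (hz : WeaklyNull z) (hz' : WeaklyNull z') :
    WeaklyNull (fun n => z n + z' n) := fun f => by
  simpa using (hz f).add (hz' f)

theorem WeaklyNull.exists_norm_le {z : ℕ → X} (hz : WeaklyNull z) :
    ∃ C, ∀ n, ‖z n‖ ≤ C := by
  obtain ⟨C, hC⟩ := banach_steinhaus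
    (g := fun n => NormedSpace.inclusionInDoubleDual ℝ X (z n)) (fun f => by
      obtain ⟨C, hC⟩ := (hz f).norm.bddAbove_range
      exact ⟨C, fun n => by simpa using hC ⟨n, rfl⟩⟩)
  exact ⟨C, fun n =>
    ((NormedSpace.inclusionInDoubleDualLi (E := X) ℝ).norm_map (z n)).ge.trans (hC n)⟩

/-- Selecting a weakly null sequence of two-term combinations satisfying a given property. -/
theorem WeaklyNull.exists_seq_of_pairs {y : ℕ → X} (hy : WeaklyNull y) (a b : ℝ) {P : X → Prop}
    (h : ∀ N, ∃ m, N ≤ m ∧ ∃ n, N ≤ n ∧ P (a • y m + b • y n)) :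
    ∃ z : ℕ → X, WeaklyNull z ∧ ∀ k, P (z k) := by
  choose m hm n hn hP using h
  exact ⟨fun k => a • y (m k) + b • y (n k),
    ((hy.comp_tendsto (tendsto_atTop_mono hm tendsto_id)).const_smul a).add
      ((hy.comp_tendsto (tendsto_atTop_mono hn tendsto_id)).const_smul b), hP⟩

/-- Continuous convex functions are weakly sequentially lower semicontinuous. -/
theorem WeaklyNull.eventually_lt_of_convexOn {z : ℕ → X} (hz : WeaklyNull z) {G : X → ℝ}
    (hG : ConvexOn ℝ Set.univ G) (hGc : Continuous G) {x : X} {α : ℝ} (hα : α < G x) :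
    ∀ᶠ m in atTop, α < G (x + z m) := by
  have hconv : Convex ℝ {w | G w ≤ α} := by simpa using hG.convex_le α
  have hclosed : IsClosed {w | G w ≤ α} := isClosed_le hGc continuous_const
  obtain ⟨f, u, hfx, hfu⟩ :=
    geometric_hahn_banach_point_closed hconv hclosed (x := x) (by simpa using hα)
  have ht : Tendsto (fun m => f (x + z m)) atTop (𝓝 (f x)) := by
    simpa using (hz f).const_add (f x)
  filter_upwards [ht.eventually_lt_const hfx] with m hm
  by_contra! hle
  exact lt_asymm hm (hfu _ hle)

theorem RWCoeff.le_of_mem {x : X} {z : ℕ → X} (hx : ‖x‖ ≤ 1) (hz1 : ∀ n, ‖z n‖ ≤ 1)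
    (hz : WeaklyNull z) :
    min (liminf (fun n => ‖z n + x‖) atTop) (liminf (fun n => ‖z n - x‖) atTop) ≤
      RWCoeff X 1 := by
  refine le_csSup ⟨2, ?_⟩ ⟨x, z, hx, hz1, hz, rfl⟩
  rintro _ ⟨x, z, hx, hz1, -, rfl⟩
  refine (min_le_left _ _).trans (liminf_le_of_le ⟨0, by simp⟩ fun b hb => ?_)
  obtain ⟨n, hn⟩ := hb.exists
  linarith [norm_add_le (z n) x, hz1 n]

theorem false_of_RWCoeff_eq_one (hRW : RWCoeff X 1 = 1) {z : ℕ → X} (hz : WeaklyNull z) {w : X}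
    {r c : ℝ} (hr : 0 < r) (hrc : r < c) (hw : ‖w‖ ≤ r)
    (h : ∀ n, ‖z n‖ ≤ r ∧ c ≤ ‖w + z n‖ ∧ c ≤ ‖w - z n‖) : False := by
  have hs : ∀ v : X, ‖r⁻¹ • v‖ = ‖v‖ / r := fun v => by
    rw [norm_smul, norm_inv, Real.norm_of_nonneg hr.le, div_eq_inv_mul]
  have hle : ∀ v : X, ‖v‖ ≤ r → ‖r⁻¹ • v‖ ≤ 1 := fun v hv => by
    rw [hs]; exact (div_le_one hr).2 hv
  have hzn : ∀ n, ‖r⁻¹ • z n‖ ≤ 1 := fun n => hle _ (h n).1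
  have key := RWCoeff.le_of_mem (hle w hw) hzn (hz.const_smul r⁻¹)
  rw [hRW] at key
  have hc : 1 < c / r := (one_lt_div hr).2 hrc
  have hlim : ∀ u : ℕ → X, (∀ n, ‖u n‖ ≤ 2) → (∀ n, c / r ≤ ‖u n‖) →
      c / r ≤ liminf (fun n => ‖u n‖) atTop := fun u hu2 hu =>
    le_liminf_of_le (isBoundedUnder_of ⟨2, hu2⟩).isCoboundedUnder_ge
      (Eventually.of_forall hu)
  have h1 : c / r ≤ liminf (fun n => ‖r⁻¹ • z n + r⁻¹ • w‖) atTop := by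
    refine hlim _ (fun n => ?_) fun n => ?_
    · linarith [norm_add_le (r⁻¹ • z n) (r⁻¹ • w), hzn n, hle w hw]
    · rw [← smul_add, hs, add_comm]
      exact div_le_div_of_nonneg_right (h n).2.1 hr.le
  have h2 : c / r ≤ liminf (fun n => ‖r⁻¹ • z n - r⁻¹ • w‖) atTop := by
    refine hlim _ (fun n => ?_) fun n => ?_
    · linarith [norm_sub_le (r⁻¹ • z n) (r⁻¹ • w), hzn n, hle w hw]
    · rw [← smul_sub, hs, norm_sub_rev]
      exact div_le_div_of_nonneg_right (h n).2.2 hr.le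
  exact absurd key (not_le.2 (hc.trans_le (le_min h1 h2)))

theorem NonstrictOpial.le_of_forall (hO : NonstrictOpial X) {z : ℕ → X} (hz : WeaklyNull z)
    {x : X} {a b : ℝ} (h : ∀ n, a ≤ ‖z n‖ ∧ ‖x + z n‖ ≤ b) : a ≤ b := by
  obtain ⟨C, hC⟩ := hz.exists_norm_le
  have h1 : a ≤ limsup (fun n => ‖z n‖) atTop :=
    le_limsup_of_frequently_le (Eventually.of_forall fun n => (h n).1).frequently
      (isBoundedUnder_of ⟨C, hC⟩)
  have h2 : limsup (fun n => ‖z n + x‖) atTop ≤ b :=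
    limsup_le_of_le (isBoundedUnder_of ⟨0, fun n => norm_nonneg _⟩).isCoboundedUnder_le
      (Eventually.of_forall fun n => by rw [add_comm]; exact (h n).2)
  exact h1.trans ((hO z x hz).trans h2)

theorem Ultrafilter.exists_tendsto_of_abs_le (U : Ultrafilter ℕ) {u : ℕ → ℝ} {C : ℝ}
    (hu : ∀ n, |u n| ≤ C) : ∃ l, Tendsto u U (𝓝 l) := by
  obtain ⟨l, -, hl⟩ := (isCompact_Icc (a := -C) (b := C)).ultrafilter_le_nhds (U.map u)
    (le_principal_iff.2 (mem_map.2 (univ_mem' fun n => abs_le.1 (hu n))))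
  exact ⟨l, hl⟩

theorem norm_add_le_of_weaklyNull (hRW : RWCoeff X 1 = 1) (hO : NonstrictOpial X) {y : ℕ → X}
    (hy : WeaklyNull y) (hy1 : ∀ n, ‖y n‖ ≤ 1) {x : X} (hx : ‖x‖ ≤ 1) {c : ℝ}
    (hc : ∀ n, c ≤ ‖x + y n‖) : c ≤ 1 := by
  by_contra! hc1
  let U : Ultrafilter ℕ := hyperfilter ℕ
  have hU : (U : Filter ℕ) ≤ atTop := Nat.hyperfilter_le_atTop
  have hUge : ∀ N, ∀ᶠ n in (U : Filter ℕ), N ≤ n := fun N => hU (eventually_ge_atTop N)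
  have hbound : ∀ (w : X) (t : ℝ) (n : ℕ), ‖w + t • y n‖ ≤ ‖w‖ + |t| := fun w t n => by
    refine (norm_add_le _ _).trans ?_
    rw [norm_smul, Real.norm_eq_abs]
    gcongr
    exact mul_le_of_le_one_right (abs_nonneg t) (hy1 n)
  have hex : ∀ (w : X) (t : ℝ), ∃ l, Tendsto (fun n => ‖w + t • y n‖) U (𝓝 l) := fun w t =>
    U.exists_tendsto_of_abs_le (C := ‖w‖ + |t|) fun n => by
      rw [abs_of_nonneg (norm_nonneg _)]; exact hbound w t n
  choose τ hτ using hex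
  have hτ_le : ∀ w t, τ w t ≤ ‖w‖ + |t| := fun w t =>
    le_of_tendsto' (hτ w t) (hbound w t)
  have hτ_nonneg : ∀ w t, 0 ≤ τ w t := fun w t => ge_of_tendsto' (hτ w t) fun n => norm_nonneg _
  have hτ_convex : ∀ t, ConvexOn ℝ Set.univ (fun w => τ w t) := fun t => by
    refine ⟨convex_univ, fun v _ w _ a b ha hb hab => ?_⟩
    refine le_of_tendsto_of_tendsto' (hτ _ t)
      (((hτ v t).const_mul a).add ((hτ w t).const_mul b)) fun n => ?_
    have e : a • v + b • w + t • y n = a • (v + t • y n) + b • (w + t • y n) := by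
      obtain rfl : b = 1 - a := by linarith
      module
    rw [e]
    refine (norm_add_le _ _).trans_eq ?_
    rw [norm_smul, norm_smul, Real.norm_of_nonneg ha, Real.norm_of_nonneg hb]
  have hτ_lip : ∀ v w t t', τ v t ≤ τ w t' + (‖v - w‖ + |t - t'|) := fun v w t t' => by
    refine le_of_tendsto_of_tendsto' (hτ v t) ((hτ w t').add_const _) fun n => ?_
    have e : v + t • y n = (w + t' • y n) + ((v - w) + (t - t') • y n) := by module
    rw [e]
    exact (norm_add_le _ _).trans (by gcongr; exact hbound _ _ n)
  have hτ_cont : ∀ t, Continuous (fun w => τ w t) := fun t => by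
    refine (LipschitzWith.of_le_add fun v w => ?_).continuous
    simpa [dist_eq_norm] using hτ_lip v w t t
  have hτ_cont' : ∀ w, Continuous (τ w) := fun w => by
    refine (LipschitzWith.of_le_add fun s t => ?_).continuous
    simpa [Real.dist_eq] using hτ_lip w w s t
  have hτ_or : ∀ (w : X) (t r : ℝ), 0 < r → ‖w‖ ≤ r → |t| ≤ r → τ w t ≤ r ∨ τ w (-t) ≤ r := by
    intro w t r hr hw ht
    by_contra! hlt
    obtain ⟨c', hrc', hc'⟩ := exists_between (lt_min hlt.1 hlt.2)
    obtain ⟨z, hz, hzP⟩ := hy.exists_seq_of_pairs t 0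
      (P := fun z => ‖z‖ ≤ r ∧ c' ≤ ‖w + z‖ ∧ c' ≤ ‖w - z‖) fun N => by
        obtain ⟨n, hn, h1, h2⟩ := ((hUge N).and
          (((hτ w t).eventually_const_lt (hc'.trans_le (min_le_left _ _))).and
          ((hτ w (-t)).eventually_const_lt (hc'.trans_le (min_le_right _ _))))).exists
        refine ⟨n, hn, n, hn, ?_, ?_, ?_⟩
        · simpa using (hbound 0 t n).trans (by simpa using ht)
        · simpa using h1.le
        · simpa [sub_eq_add_neg] using h2.le
    exact false_of_RWCoeff_eq_one hRW hz hr hrc' hw hzP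
  obtain ⟨d, hd⟩ : ∃ d, Tendsto (fun m => τ (y m) (-1)) U (𝓝 d) :=
    U.exists_tendsto_of_abs_le (C := 2) fun n => by
      rw [abs_of_nonneg (hτ_nonneg _ _)]
      have := hτ_le (y n) (-1)
      rw [abs_neg, abs_one] at this
      linarith [hy1 n]
  have hτx : c ≤ τ x 1 := ge_of_tendsto' (hτ x 1) fun n => by simpa using hc n
  rcases le_or_gt d 1 with hd1 | hd1
  · obtain ⟨c', hc'1, hc'⟩ := exists_between hc1
    obtain ⟨r, hr1, hr⟩ := exists_between hc'1
    obtain ⟨z, hz, hzP⟩ := hy.exists_seq_of_pairs 1 (-1)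
      (P := fun z => ‖z‖ ≤ r ∧ c' ≤ ‖x + z‖ ∧ c' ≤ ‖x - z‖) fun N => by
        obtain ⟨m, hm, hm1, hm2⟩ := ((hUge N).and ((hd.eventually_lt_const (hd1.trans_lt hr1)).and
          (hU ((hy.const_smul (-1)).eventually_lt_of_convexOn (hτ_convex 1) (hτ_cont 1)
            (hc'.trans_le hτx))))).exists
        obtain ⟨n, hn, hn1, hn2, hn3⟩ := ((hUge N).and
          (((hτ _ _).eventually_lt_const hm1).and (((hτ _ _).eventually_const_lt hm2).and
          (hU ((hy.const_smul (-1)).eventually_lt_of_convexOn (convexOn_norm convex_univ)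
            continuous_norm (hc'.trans_le (hc m))))))).exists
        refine ⟨m, hm, n, hn, ?_, ?_, ?_⟩
        · simpa using hn1.le
        · rw [one_smul, ← add_assoc]; exact hn3.le
        · have e : x - ((1 : ℝ) • y m + (-1 : ℝ) • y n) = x + (-1 : ℝ) • y m + (1 : ℝ) • y n := by
            module
          rw [e]; exact hn2.le
    exact false_of_RWCoeff_eq_one hRW hz (by linarith) hr (by linarith) hzP
  · obtain ⟨k, hk1, hk⟩ := exists_between (lt_min hd1 hc1)
    have hkd : k < d := hk.trans_le (min_le_left _ _)
    have hkc : k < c := hk.trans_le (min_le_right _ _)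
    obtain ⟨s, hs1, hsk⟩ : ∃ s, 1 ≤ s ∧ τ x s = k * s := by
      let M := max 1 (1 / (k - 1))
      have hM : 1 ≤ (k - 1) * M := by
        have := mul_le_mul_of_nonneg_left (le_max_right 1 (1 / (k - 1))) (sub_pos.2 hk1).le
        rwa [mul_one_div_cancel (sub_pos.2 hk1).ne'] at this
      have hM1 : 1 ≤ M := le_max_left _ _
      have hcont : ContinuousOn (fun s => τ x s - k * s) (Set.Icc 1 M) :=
        ((hτ_cont' x).sub (continuous_const.mul continuous_id)).continuousOn
      obtain ⟨s, hs, hs0⟩ := intermediate_value_Icc' hM1 hcont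
        (show (0 : ℝ) ∈ Set.Icc _ _ from ⟨by
          have := hτ_le x M
          rw [abs_of_nonneg (by linarith)] at this
          linarith, by linarith⟩)
      exact ⟨s, hs.1, sub_eq_zero.1 hs0⟩
    let A := k * s
    have hsA : s < A := by simpa [A] using mul_lt_mul_of_pos_right hk1 (by linarith : 0 < s)
    have hA0 : 0 < A := by linarith
    have hτA : A < τ x A := by
      have h : τ x s ≤ (1 - s / A) * 1 + s / A * τ x A := by
        refine le_of_tendsto_of_tendsto' (hτ x s) (((hτ x A).const_mul _).const_add _) fun n => ?_
        have h0 : 0 ≤ 1 - s / A := sub_nonneg.2 ((div_le_one hA0).2 hsA.le)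
        have e : x + s • y n = (1 - s / A) • x + (s / A) • (x + A • y n) := by
          rw [smul_add, smul_smul, div_mul_cancel₀ _ hA0.ne']; module
        rw [e]
        refine (norm_add_le _ _).trans ?_
        rw [norm_smul, norm_smul, Real.norm_of_nonneg h0, Real.norm_of_nonneg (by positivity)]
        gcongr
      by_contra! hle
      have h' : A ≤ (1 - s / A) * 1 + s / A * A :=
        (hsk.symm.le.trans h).trans (by gcongr)
      rw [div_mul_cancel₀ _ hA0.ne'] at h'
      have h2 : (1 - s / A) * A = A - s := by field_simp
      nlinarith
    obtain ⟨δ, hδ, hδd, hδτ⟩ : ∃ δ, 0 < δ ∧ A + δ < s * d ∧ A + δ < τ x A := by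
      have h1 : A < s * d := by
        rw [mul_comm s]; exact mul_lt_mul_of_pos_right hkd (by linarith)
      obtain ⟨q, hq, hq'⟩ := exists_between (lt_min h1 hτA)
      refine ⟨q - A, sub_pos.2 hq, ?_, ?_⟩
      · simpa using hq'.trans_le (min_le_left _ _)
      · simpa using hq'.trans_le (min_le_right _ _)
    obtain ⟨b, hb, hbd⟩ := exists_between hδd
    obtain ⟨a, ha, had⟩ := exists_between hb
    obtain ⟨z, hz, hzP⟩ := hy.exists_seq_of_pairs s (-s)
      (P := fun z => b ≤ ‖z‖ ∧ ‖x + z‖ ≤ a) fun N => by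
        obtain ⟨m, hm, hm1, hm2, hm3⟩ := ((hUge N).and
          (((hd.const_mul s).eventually_const_lt hbd).and
          (((hτ x s).eventually_lt_const (show τ x s < A + δ by linarith)).and
          (hU ((hy.const_smul s).eventually_lt_of_convexOn (hτ_convex A) (hτ_cont A)
            hδτ))))).exists
        have hneg := (hτ_or (x + s • y m) A (A + δ) (by linarith) hm2.le
          (by rw [abs_of_pos hA0]; linarith)).resolve_left (not_le.2 hm3)
        obtain ⟨n, hn, hn1, hn2⟩ := ((hUge N).and
          ((((hτ _ _).const_mul s).eventually_const_lt hm1).and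
          ((hτ _ _).eventually_lt_const (hneg.trans_lt ha)))).exists
        refine ⟨m, hm, n, hn, ?_, ?_⟩
        · have e : s • y m + (-s) • y n = s • (y m + (-1 : ℝ) • y n) := by module
          rw [e, norm_smul, Real.norm_of_nonneg (by linarith)]
          exact hn1.le
        · have h0 : 0 ≤ 1 - s / A := sub_nonneg.2 ((div_le_one hA0).2 hsA.le)
          have e : x + (s • y m + (-s) • y n) =
              (1 - s / A) • (x + s • y m) + (s / A) • (x + s • y m + (-A) • y n) := by
            rw [smul_add (s / A) (x + s • y m), smul_smul, mul_neg, div_mul_cancel₀ _ hA0.ne']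
            module
          rw [e]
          refine (norm_add_le _ _).trans ?_
          rw [norm_smul, norm_smul, Real.norm_of_nonneg h0, Real.norm_of_nonneg (by positivity)]
          calc (1 - s / A) * ‖x + s • y m‖ + s / A * ‖x + s • y m + (-A) • y n‖
              ≤ (1 - s / A) * a + s / A * a := by
                gcongr
                linarith
            _ = a := by ring
    exact absurd (hO.le_of_forall hz hzP) (not_le.2 had)

end WeaklyNull

theorem stmt13 (X : Type*) [NormedAddCommGroup X] [NormedSpace ℝ X] [CompleteSpace X]
    [TopologicalSpace.SeparableSpace X]
    (hRW : RWCoeff X 1 = 1)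
    (hOpial : ∀ (xs : ℕ → X) (x : X),
      (∀ f : X →L[ℝ] ℝ, Filter.Tendsto (fun n => f (xs n)) Filter.atTop (nhds 0)) →
      Filter.limsup (fun n => ‖xs n‖) Filter.atTop ≤
        Filter.limsup (fun n => ‖xs n + x‖) Filter.atTop) :
    ∀ (xs : ℕ → X) (x : X),
      (∀ f : X →L[ℝ] ℝ, Filter.Tendsto (fun n => f (xs n)) Filter.atTop (nhds 0)) →
      Filter.limsup (fun n => ‖xs n + x‖) Filter.atTop =
        max (Filter.limsup (fun n => ‖xs n‖) Filter.atTop) ‖x‖ := by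
  intro xs x hxs
  have hxs' : WeaklyNull xs := hxs
  obtain ⟨C, hC⟩ := hxs'.exists_norm_le
  have hbd : IsBoundedUnder (· ≤ ·) atTop (fun n => ‖xs n‖) := isBoundedUnder_of ⟨C, hC⟩
  have hbd' : IsBoundedUnder (· ≤ ·) atTop (fun n => ‖xs n + x‖) :=
    isBoundedUnder_of ⟨C + ‖x‖, fun n => (norm_add_le _ _).trans (by gcongr; exact hC n)⟩
  refine le_antisymm ?_ (max_le (hOpial xs x hxs) ?_)
  · by_contra! hlt
    obtain ⟨c, hc, hc'⟩ := exists_between hlt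
    obtain ⟨r, hr, hrc⟩ := exists_between hc
    have hr0 : 0 < r := (norm_nonneg x).trans_lt ((le_max_right _ _).trans_lt hr)
    have hfreq : ∃ᶠ n in atTop, c < ‖xs n + x‖ ∧ ‖xs n‖ < r :=
      (frequently_lt_of_lt_limsup
        (isBoundedUnder_of ⟨0, fun n => norm_nonneg _⟩).isCoboundedUnder_le hc').and_eventually
        (eventually_lt_of_limsup_lt ((le_max_left _ _).trans_lt hr) hbd)
    obtain ⟨φ, hφ, hφP⟩ := extraction_of_frequently_atTop hfreq
    have hs : ∀ v : X, ‖r⁻¹ • v‖ = ‖v‖ / r := fun v => by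
      rw [norm_smul, norm_inv, Real.norm_of_nonneg hr0.le, div_eq_inv_mul]
    have hle : ∀ v : X, ‖v‖ ≤ r → ‖r⁻¹ • v‖ ≤ 1 := fun v hv => by
      rw [hs]; exact (div_le_one hr0).2 hv
    have key : c / r ≤ 1 := norm_add_le_of_weaklyNull hRW hOpial
      ((hxs'.comp_tendsto hφ.tendsto_atTop).const_smul r⁻¹)
      (fun n => hle _ (hφP n).2.le) (hle x ((le_max_right _ _).trans hr.le)) fun n => by
        rw [← smul_add, hs, add_comm]
        exact div_le_div_of_nonneg_right (hφP n).1.le hr0.le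
    exact absurd ((div_le_one hr0).1 key) (not_le.2 hrc)
  · refine le_of_forall_lt fun α hα => ?_
    obtain ⟨β, hαβ, hβ⟩ := exists_between hα
    have hev := hxs'.eventually_lt_of_convexOn (convexOn_norm convex_univ) continuous_norm hβ
    refine hαβ.trans_le (le_limsup_of_frequently_le (Eventually.frequently ?_) hbd')
    filter_upwards [hev] with n hn
    rw [add_comm]
    exact hn.le
end
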